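/- arXiv:1910.04830 — 6 statements merged into one kernel-verified Lean document; each statement's English description precedes it below -/
import Mathlib

section
/- Let b be a nonconstant element of the closed unit ball H∞₁ of the bounded holomorphic functions on the open unit disk 𝔻. Then H(b) has the complete Nevanlinna–Pick property if and only if there exists a holomorphic function h defined on the image b(𝔻) such that (1) h(b(z)) = z for all z ∈ 𝔻, and (2) the function z ↦ (z − b(0))/h(z) extends to a holomorphic function on all of 𝔻 satisfying |(z − b(0))/h(z)| ≤ |1 − conj(b(0))·z| for all z ∈ 𝔻. -/
open Complex Set Filter MeasureTheory

noncomputable section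

/-- The open unit disk in `ℂ`. -/
def unitDisk : Set ℂ := Metric.ball 0 1

/-- `K` is a positive kernel on the unit disk: it is Hermitian symmetric and all
finite Gram-type sums are (real and) nonnegative. -/
def IsPosKernel (K : ℂ → ℂ → ℂ) : Prop :=
  (∀ z ∈ unitDisk, ∀ w ∈ unitDisk, K z w = starRingEnd ℂ (K w z)) ∧
  ∀ (n : ℕ) (lam : Fin n → ℂ), (∀ i, lam i ∈ unitDisk) →
    ∀ c : Fin n → ℂ,
      0 ≤ (∑ i, ∑ j, c i * starRingEnd ℂ (c j) * K (lam i) (lam j)).re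

/-- `b` belongs to the closed unit ball `H∞₁` of bounded holomorphic functions on
the unit disk. -/
def MemBallHinf (b : ℂ → ℂ) : Prop :=
  DifferentiableOn ℂ b unitDisk ∧ ∀ z ∈ unitDisk, ‖b z‖ ≤ 1

/-- `b` is nonconstant on the unit disk. -/
def NonconstOnDisk (b : ℂ → ℂ) : Prop :=
  ∃ z ∈ unitDisk, ∃ w ∈ unitDisk, b z ≠ b w

/-- The de Branges–Rovnyak kernel `k^b(z,w) = (1 - conj (b w) * b z) / (1 - conj w * z)`. -/
def dbrKernel (b : ℂ → ℂ) (z w : ℂ) : ℂ :=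
  (1 - starRingEnd ℂ (b w) * b z) / (1 - starRingEnd ℂ w * z)

/-- The de Branges–Rovnyak space `H(b)` has the complete Nevanlinna–Pick property:
`k^b` never vanishes on `𝔻 × 𝔻` and
`(z,w) ↦ 1 - k^b(z,0) k^b(0,w) / (k^b(0,0) k^b(z,w))` is a positive kernel. -/
def HasCNP (b : ℂ → ℂ) : Prop :=
  (∀ z ∈ unitDisk, ∀ w ∈ unitDisk, dbrKernel b z w ≠ 0) ∧
  IsPosKernel (fun z w =>
    1 - dbrKernel b z 0 * dbrKernel b 0 w / (dbrKernel b 0 0 * dbrKernel b z w))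

/-- `f` belongs to the Hardy space `H²` with Taylor coefficient sequence `a`:
`f z = ∑ₙ a n * zⁿ` on the unit disk and `∑ₙ ‖a n‖² < ∞`. -/
def MemH2 (f : ℂ → ℂ) (a : ℕ → ℂ) : Prop :=
  (∀ z ∈ unitDisk, HasSum (fun n => a n * z ^ n) (f z)) ∧
  Summable (fun n => ‖a n‖ ^ 2)


open scoped ComplexConjugate

theorem IsPosKernel.congr {K K' : ℂ → ℂ → ℂ} (hK : IsPosKernel K)
    (h : ∀ z ∈ unitDisk, ∀ w ∈ unitDisk, K z w = K' z w) : IsPosKernel K' := by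
  refine ⟨fun z hz w hw => ?_, fun n lam hlam c => ?_⟩
  · rw [← h z hz w hw, ← h w hw z hz]
    exact hK.1 z hz w hw
  · simpa only [h _ (hlam _) _ (hlam _)] using hK.2 n lam hlam c

theorem IsPosKernel.finset_sum_nonneg {K : ℂ → ℂ → ℂ} (hK : IsPosKernel K) {ι : Type*}
    (s : Finset ι) (lam : ι → ℂ) (hlam : ∀ i ∈ s, lam i ∈ unitDisk) (c : ι → ℂ) :
    0 ≤ (∑ i ∈ s, ∑ j ∈ s, c i * conj (c j) * K (lam i) (lam j)).re := by
  have h := hK.2 s.card (fun k => lam (s.equivFin.symm k))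
    (fun k => hlam _ (s.equivFin.symm k).2) (fun k => c (s.equivFin.symm k))
  convert h using 2
  rw [← Finset.sum_coe_sort, ← s.equivFin.symm.sum_comp]
  refine Finset.sum_congr rfl fun k _ => ?_
  rw [← Finset.sum_coe_sort, ← s.equivFin.symm.sum_comp]

section Szego

/-- The sequence `(uⁿ)ₙ` as an element of `ℓ²`. -/
def powSeq (u : Metric.ball (0 : ℂ) 1) : lp (fun _ : ℕ => ℂ) 2 :=
  ⟨fun n => (u : ℂ) ^ n, by
    have hu : ‖(u : ℂ)‖ < 1 := mem_ball_zero_iff.1 u.2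
    apply memℓp_gen
    have : Summable fun n : ℕ => (‖(u : ℂ)‖ ^ 2) ^ n :=
      summable_geometric_of_lt_one (by positivity) (by nlinarith [norm_nonneg (u : ℂ)])
    refine this.congr fun n => ?_
    simp only [ENNReal.toReal_ofNat, norm_pow, Real.rpow_two]
    ring⟩

theorem powSeq_apply (u : Metric.ball (0 : ℂ) 1) (n : ℕ) : powSeq u n = (u : ℂ) ^ n := rfl

theorem inner_powSeq (u v : Metric.ball (0 : ℂ) 1) :
    inner ℂ (powSeq v) (powSeq u) = (1 - (u : ℂ) * conj (v : ℂ))⁻¹ := by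
  have hu : ‖(u : ℂ)‖ < 1 := mem_ball_zero_iff.1 u.2
  have hv : ‖(v : ℂ)‖ < 1 := mem_ball_zero_iff.1 v.2
  have h1 : HasSum (fun n : ℕ => ((u : ℂ) * conj (v : ℂ)) ^ n) (1 - (u : ℂ) * conj (v : ℂ))⁻¹ := by
    apply hasSum_geometric_of_norm_lt_one
    rw [norm_mul, Complex.norm_conj]
    exact mul_lt_one_of_nonneg_of_lt_one_left (norm_nonneg _) hu hv.le
  refine (lp.hasSum_inner (𝕜 := ℂ) (powSeq v) (powSeq u)).unique ?_
  have e : (fun n => inner ℂ (powSeq v n) (powSeq u n)) =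
      fun n => ((u : ℂ) * conj (v : ℂ)) ^ n := funext fun n => by
    simp [powSeq_apply, mul_pow]
  rwa [e]

theorem norm_sq_powSeq (u : Metric.ball (0 : ℂ) 1) :
    ‖powSeq u‖ ^ 2 * (1 - ‖(u : ℂ)‖ ^ 2) = 1 := by
  have hu : ‖(u : ℂ)‖ < 1 := mem_ball_zero_iff.1 u.2
  have h := inner_powSeq u u
  rw [inner_self_eq_norm_sq_to_K, Complex.mul_conj, Complex.normSq_eq_norm_sq] at h
  have h2 : ‖powSeq u‖ ^ 2 = (1 - ‖(u : ℂ)‖ ^ 2)⁻¹ := by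
    apply Complex.ofReal_injective
    push_cast at h ⊢
    exact h
  rw [h2]
  exact inv_mul_cancel₀ (by nlinarith [norm_nonneg (u : ℂ)])

theorem norm_sq_sum_powSeq {ι : Type*} (s : Finset ι) (u : ι → Metric.ball (0 : ℂ) 1)
    (c : ι → ℂ) :
    ‖∑ i ∈ s, c i • powSeq (u i)‖ ^ 2 =
      (∑ i ∈ s, ∑ j ∈ s, c i * conj (c j) * (1 - (u i : ℂ) * conj (u j : ℂ))⁻¹).re := by
  rw [← inner_self_eq_norm_sq (𝕜 := ℂ), inner_sum]
  simp only [sum_inner, inner_smul_left, inner_smul_right, inner_powSeq, RCLike.re_to_complex,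
    Finset.mul_sum]
  congr 1
  refine Finset.sum_congr rfl fun i _ => Finset.sum_congr rfl fun j _ => by ring

theorem differentiableOn_clm_powSeq (Λ : lp (fun _ : ℕ => ℂ) 2 →L[ℂ] ℂ) :
    ∃ F : ℂ → ℂ, DifferentiableOn ℂ F (Metric.ball 0 1) ∧
      ∀ u : Metric.ball (0 : ℂ) 1, F u = Λ (powSeq u) := by
  set a := (InnerProductSpace.toDual ℂ (lp (fun _ : ℕ => ℂ) 2)).symm Λ with ha
  refine ⟨fun z => ∑' n, conj (a n) * z ^ n, ?_, fun u => ?_⟩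
  · intro z hz
    obtain ⟨r, hzr, hr1⟩ := exists_between (show ‖z‖ < 1 by simpa using hz)
    have hr0 : 0 ≤ r := (norm_nonneg z).trans hzr.le
    refine (DifferentiableOn.differentiableAt (s := Metric.ball 0 r) ?_
      (Metric.isOpen_ball.mem_nhds (by simpa using hzr))).differentiableWithinAt
    refine differentiableOn_tsum_of_summable_norm (u := fun n => ‖a‖ * r ^ n)
      ((summable_geometric_of_lt_one hr0 hr1).mul_left _) (fun n => by fun_prop)
      Metric.isOpen_ball fun n w hw => ?_
    rw [norm_mul, norm_pow, Complex.norm_conj]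
    have hw : ‖w‖ < r := by simpa using hw
    gcongr
    exact lp.norm_apply_le_norm (by simp) a n
  · have h1 : Λ (powSeq u) = inner ℂ a (powSeq u) := by
      rw [ha, InnerProductSpace.toDual_symm_apply]
    rw [h1, lp.inner_eq_tsum]
    refine tsum_congr fun n => ?_
    simp [powSeq_apply, mul_comm]

end Szego

theorem exists_clm_apply_eq {E ι : Type*} [NormedAddCommGroup E] [NormedSpace ℂ E]
    (x : ι → E) (t : ι → ℂ)
    (h : ∀ (s : Finset ι) (c : ι → ℂ), ‖∑ i ∈ s, c i * t i‖ ≤ ‖∑ i ∈ s, c i • x i‖) :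
    ∃ Λ : E →L[ℂ] ℂ, ‖Λ‖ ≤ 1 ∧ ∀ i, Λ (x i) = t i := by
  let L := Finsupp.linearCombination ℂ x
  let T := Finsupp.linearCombination ℂ t
  have hLT : ∀ c, ‖T c‖ ≤ ‖L c‖ := fun c => by
    simpa [L, T, Finsupp.linearCombination_apply, Finsupp.sum] using h c.support c
  obtain ⟨r, hr⟩ := L.rangeRestrict.exists_rightInverse_of_surjective L.range_rangeRestrict
  have hr' : ∀ y : LinearMap.range L, L (r y) = y := fun y =>
    congrArg Subtype.val (LinearMap.congr_fun hr y)
  let Λ₀ : LinearMap.range L →L[ℂ] ℂ := (T ∘ₗ r).mkContinuous 1 fun y => by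
    simpa [hr' y] using hLT (r y)
  obtain ⟨Λ, hΛ, hΛn⟩ := exists_extension_norm_eq (LinearMap.range L) Λ₀
  refine ⟨Λ, hΛn.trans_le (LinearMap.mkContinuous_norm_le _ zero_le_one _), fun i => ?_⟩
  have hLi : L (Finsupp.single i 1) = x i := by simp [L]
  have h1 := hΛ ⟨x i, Finsupp.single i 1, hLi⟩
  refine h1.trans ?_
  have h2 : T (r ⟨x i, Finsupp.single i 1, hLi⟩ - Finsupp.single i 1) = 0 := by
    rw [← norm_le_zero_iff]
    refine (hLT _).trans ?_
    rw [map_sub, hr', hLi]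
    simp
  rw [map_sub, sub_eq_zero] at h2
  refine Eq.trans ?_ (h2.trans (by simp [T]))
  rfl

theorem exists_interpolation_pow {ι : Type*} (u : ι → Metric.ball (0 : ℂ) 1) (p : ι → ℂ)
    (h : ∀ (s : Finset ι) (c : ι → ℂ), 0 ≤ (∑ i ∈ s, ∑ j ∈ s, c i * conj (c j) *
      ((1 - p i * conj (p j)) / (1 - (u i : ℂ) * conj (u j : ℂ)))).re) (n : ℕ) :
    ∃ F : ℂ → ℂ, DifferentiableOn ℂ F (Metric.ball 0 1) ∧ (∀ i, F (u i) = p i ^ n) ∧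
      ∀ z ∈ Metric.ball (0 : ℂ) 1, ‖F z‖ ^ 2 * (1 - ‖z‖ ^ 2) ≤ 1 := by
  have step : ∀ (s : Finset ι) (c : ι → ℂ),
      ‖∑ i ∈ s, (c i * p i) • powSeq (u i)‖ ≤ ‖∑ i ∈ s, c i • powSeq (u i)‖ := by
    intro s c
    refine le_of_sq_le_sq ?_ (norm_nonneg _)
    rw [norm_sq_sum_powSeq, norm_sq_sum_powSeq, ← sub_nonneg, ← Complex.sub_re,
      ← Finset.sum_sub_distrib]
    simp only [← Finset.sum_sub_distrib]
    refine (h s c).trans_eq (congrArg _ ?_)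
    refine Finset.sum_congr rfl fun i _ => Finset.sum_congr rfl fun j _ => ?_
    rw [map_mul]
    ring
  have iter : ∀ (n : ℕ) (s : Finset ι) (c : ι → ℂ),
      ‖∑ i ∈ s, (c i * p i ^ n) • powSeq (u i)‖ ≤ ‖∑ i ∈ s, c i • powSeq (u i)‖ := by
    intro n s c
    induction n with
    | zero => simp
    | succ n ih =>
      refine le_trans ?_ ((step s fun i => c i * p i ^ n).trans ih)
      simp only [pow_succ, mul_assoc, le_refl]
  obtain ⟨Λ, hΛ, hΛu⟩ := exists_clm_apply_eq (fun i => powSeq (u i)) (fun i => p i ^ n) (by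
    intro s c
    refine le_trans ?_ (iter n s c)
    have := lp.norm_apply_le_norm (p := 2) (by simp) (∑ i ∈ s, (c i * p i ^ n) • powSeq (u i)) 0
    rw [lp.coeFn_sum] at this
    simpa [powSeq_apply] using this)
  obtain ⟨F, hF, hFΛ⟩ := differentiableOn_clm_powSeq Λ
  refine ⟨F, hF, fun i => (hFΛ _).trans (hΛu i), fun z hz => ?_⟩
  have h1 : ‖F z‖ ≤ ‖powSeq ⟨z, hz⟩‖ := by
    rw [hFΛ ⟨z, hz⟩]
    simpa using Λ.le_of_opNorm_le hΛ (powSeq ⟨z, hz⟩)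
  have h2 := norm_sq_powSeq ⟨z, hz⟩
  have hz' : ‖z‖ < 1 := by simpa using hz
  refine le_trans ?_ h2.le
  gcongr
  nlinarith [norm_nonneg z]

theorem one_sub_mul_ne_zero {x y : ℂ} (hx : ‖x‖ < 1) (hy : ‖y‖ ≤ 1) : 1 - x * y ≠ 0 := by
  intro h
  have h1 : ‖x * y‖ = 1 := by rw [← sub_eq_zero.1 h, norm_one]
  rw [norm_mul] at h1
  nlinarith [norm_nonneg x, norm_nonneg y]

section PickMatrix

open Metric Real Topology

theorem diffContOnCl_sum_szego {ι : Type*} (s : Finset ι) (u d : ι → ℂ)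
    (hu : ∀ i ∈ s, ‖u i‖ < 1) :
    DiffContOnCl ℂ (fun ζ => ∑ i ∈ s, d i * (1 - conj (u i) * ζ)⁻¹) (ball 0 1) := by
  have h : DifferentiableOn ℂ (fun ζ => ∑ i ∈ s, d i * (1 - conj (u i) * ζ)⁻¹)
      (closedBall 0 1) := by
    refine DifferentiableOn.fun_sum fun i hi => ?_
    refine DifferentiableOn.const_mul (DifferentiableOn.fun_inv (by fun_prop) fun ζ hζ => ?_) _
    exact one_sub_mul_ne_zero (by simpa using hu i hi) (by simpa using hζ)
  refine DifferentiableOn.diffContOnCl ?_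
  rwa [closure_ball _ one_ne_zero]

theorem circleAverage_mul_conj_szego {f : ℂ → ℂ} (hf : DiffContOnCl ℂ f (ball 0 1)) {v : ℂ}
    (hv : ‖v‖ < 1) :
    circleAverage (fun ζ => f ζ * conj ((1 - conj v * ζ)⁻¹)) 0 1 = f v := by
  have h := DiffContOnCl.circleAverage_smul_div (c := 0) (R := 1) (w := v) (f := f)
    (by simpa using hf) (by simpa using hv)
  rw [← h]
  refine circleAverage_congr_sphere fun ζ hζ => ?_
  have hζ1 : ‖ζ‖ = 1 := by simpa using hζ
  have hζ2 : ζ * conj ζ = 1 := by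
    rw [Complex.mul_conj, Complex.normSq_eq_norm_sq, hζ1]; simp
  have h1 : 1 - v * conj ζ ≠ 0 := one_sub_mul_ne_zero hv (by simp [hζ1])
  have h2 : ζ - v ≠ 0 := by
    intro h0
    rw [← sub_eq_zero.1 h0] at hv
    exact hv.ne hζ1
  simp only [sub_zero, smul_eq_mul, map_inv₀, map_sub, map_one, map_mul, Complex.conj_conj]
  field_simp
  linear_combination v * f ζ * hζ2

theorem circleIntegrable_mul_conj {f k : ℂ → ℂ} (hf : DiffContOnCl ℂ f (ball 0 1))
    (hk : DiffContOnCl ℂ k (ball 0 1)) : CircleIntegrable (fun ζ => f ζ * conj (k ζ)) 0 1 := by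
  refine ContinuousOn.circleIntegrable zero_le_one ?_
  have h1 := hf.continuousOn_ball.mono sphere_subset_closedBall
  have h2 := hk.continuousOn_ball.mono sphere_subset_closedBall
  exact h1.mul (Complex.continuous_conj.comp_continuousOn h2)

theorem circleAverage_mul_conj_sum_szego {ι : Type*} (s : Finset ι) (u d : ι → ℂ)
    (hu : ∀ i ∈ s, ‖u i‖ < 1) {f : ℂ → ℂ} (hf : DiffContOnCl ℂ f (ball 0 1)) :
    circleAverage (fun ζ => f ζ * conj (∑ i ∈ s, d i * (1 - conj (u i) * ζ)⁻¹)) 0 1 =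
      ∑ i ∈ s, conj (d i) * f (u i) := by
  have e : (fun ζ => f ζ * conj (∑ i ∈ s, d i * (1 - conj (u i) * ζ)⁻¹)) =
      fun ζ => ∑ i ∈ s, (conj (d i) * f ζ) * conj ((1 - conj (u i) * ζ)⁻¹) := by
    funext ζ
    rw [map_sum, Finset.mul_sum]
    refine Finset.sum_congr rfl fun i _ => ?_
    rw [map_mul]
    ring
  have hdf : ∀ i, DiffContOnCl ℂ (fun ζ => conj (d i) * f ζ) (ball 0 1) := fun i =>
    hf.const_smul (conj (d i))
  rw [e, circleAverage_fun_sum]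
  · exact Finset.sum_congr rfl fun i hi => circleAverage_mul_conj_szego (hdf i) (hu i hi)
  · intro i hi
    refine circleIntegrable_mul_conj (hdf i) ?_
    simpa using diffContOnCl_sum_szego {i} u 1 (by simpa using hu i hi)

theorem pick_nonneg_of_diffContOnCl {g : ℂ → ℂ} (hg : DiffContOnCl ℂ g (ball 0 1))
    (hg1 : ∀ ζ ∈ sphere (0 : ℂ) 1, ‖g ζ‖ ≤ 1) {ι : Type*} (s : Finset ι) (u c : ι → ℂ)
    (hu : ∀ i ∈ s, ‖u i‖ < 1) :
    0 ≤ (∑ i ∈ s, ∑ j ∈ s, c i * conj (c j) *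
      ((1 - g (u i) * conj (g (u j))) / (1 - u i * conj (u j)))).re := by
  set H : ℂ → ℂ := fun ζ => ∑ i ∈ s, conj (c i) * (1 - conj (u i) * ζ)⁻¹ with hH
  set H' : ℂ → ℂ := fun ζ => ∑ i ∈ s, (conj (c i) * conj (g (u i))) * (1 - conj (u i) * ζ)⁻¹
    with hH'
  have dH : DiffContOnCl ℂ H (ball 0 1) := diffContOnCl_sum_szego s u _ hu
  have dH' : DiffContOnCl ℂ H' (ball 0 1) := diffContOnCl_sum_szego s u _ hu
  have dA : DiffContOnCl ℂ (fun ζ => H ζ - 2 * (g ζ * H' ζ)) (ball 0 1) :=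
    dH.sub ((hg.smul dH').const_smul (2 : ℂ))
  have i1 := circleIntegrable_mul_conj dA dH
  have i2 := circleIntegrable_mul_conj dH' dH'
  have avg : circleAverage (fun ζ => (H ζ - 2 * (g ζ * H' ζ)) * conj (H ζ) +
      H' ζ * conj (H' ζ)) 0 1 = ∑ i ∈ s, ∑ j ∈ s, c i * conj (c j) *
        ((1 - g (u i) * conj (g (u j))) / (1 - u i * conj (u j))) := by
    rw [circleAverage_fun_add i1 i2, circleAverage_mul_conj_sum_szego s u _ hu dA,
      circleAverage_mul_conj_sum_szego s u _ hu dH', ← Finset.sum_add_distrib]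
    refine Finset.sum_congr rfl fun i _ => ?_
    have e : ∑ j ∈ s, c i * conj (c j) *
        ((1 - g (u i) * conj (g (u j))) / (1 - u i * conj (u j))) =
        c i * (H (u i) - g (u i) * H' (u i)) := by
      rw [hH, hH']
      simp only [Finset.mul_sum, ← Finset.sum_sub_distrib]
      refine Finset.sum_congr rfl fun j _ => ?_
      rw [mul_comm (conj (u j)) (u i)]
      ring
    rw [e]
    simp only [map_mul, Complex.conj_conj]
    ring
  rw [← avg]
  have h := Complex.reCLM.circleAverage_comp_comm (i1.add i2)
  refine le_of_le_of_eq ?_ h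
  refine circleAverage_nonneg_of_nonneg fun ζ hζ => ?_
  have hgζ : ‖g ζ‖ ≤ 1 := hg1 ζ (by simpa using hζ)
  have hn : Complex.normSq (g ζ) ≤ 1 := by
    rw [Complex.normSq_eq_norm_sq]
    exact pow_le_one₀ (norm_nonneg _) hgζ
  have key : ((H ζ - 2 * (g ζ * H' ζ)) * conj (H ζ) + H' ζ * conj (H' ζ)).re =
      Complex.normSq (H ζ - g ζ * H' ζ) +
        Complex.normSq (H' ζ) * (1 - Complex.normSq (g ζ)) := by
    generalize H ζ = x
    generalize H' ζ = y
    generalize g ζ = γ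
    simp only [Complex.normSq_apply, Complex.add_re, Complex.sub_re, Complex.sub_im,
      Complex.mul_re, Complex.mul_im, Complex.conj_re, Complex.conj_im, Complex.re_ofNat,
      Complex.im_ofNat]
    ring
  refine le_of_le_of_eq ?_ key.symm
  have := Complex.normSq_nonneg (H ζ - g ζ * H' ζ)
  have := Complex.normSq_nonneg (H' ζ)
  nlinarith

theorem pick_nonneg {g : ℂ → ℂ} (hg : DifferentiableOn ℂ g (ball 0 1))
    (hg1 : ∀ ζ ∈ ball (0 : ℂ) 1, ‖g ζ‖ ≤ 1) {ι : Type*} (s : Finset ι) (u c : ι → ℂ)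
    (hu : ∀ i ∈ s, ‖u i‖ < 1) :
    0 ≤ (∑ i ∈ s, ∑ j ∈ s, c i * conj (c j) *
      ((1 - g (u i) * conj (g (u j))) / (1 - u i * conj (u j)))).re := by
  have hlim : ∀ i ∈ s, Tendsto (fun r : ℝ => g (r * u i)) (𝓝[<] 1) (𝓝 (g (u i))) := by
    intro i hi
    have h1 : ContinuousAt g (u i) := (hg.differentiableAt
      (isOpen_ball.mem_nhds (by simpa using hu i hi))).continuousAt
    have h2 : Tendsto (fun r : ℝ => (r : ℂ) * u i) (𝓝[<] 1) (𝓝 (u i)) := by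
      have : ContinuousAt (fun r : ℝ => (r : ℂ) * u i) 1 := by fun_prop
      simpa using this.tendsto.mono_left nhdsWithin_le_nhds
    exact h1.tendsto.comp h2
  have hsum : Tendsto (fun r : ℝ => (∑ i ∈ s, ∑ j ∈ s, c i * conj (c j) *
      ((1 - g (r * u i) * conj (g (r * u j))) / (1 - u i * conj (u j)))).re) (𝓝[<] 1)
      (𝓝 (∑ i ∈ s, ∑ j ∈ s, c i * conj (c j) *
      ((1 - g (u i) * conj (g (u j))) / (1 - u i * conj (u j)))).re) := by
    refine (Complex.continuous_re.tendsto _).comp ?_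
    refine tendsto_finsetSum _ fun i hi => tendsto_finsetSum _ fun j hj => ?_
    refine Tendsto.const_mul _ (Tendsto.div_const (Tendsto.const_sub _ ?_) _)
    exact (hlim i hi).mul ((Complex.continuous_conj.tendsto _).comp (hlim j hj))
  refine ge_of_tendsto hsum ?_
  filter_upwards [Ioo_mem_nhdsLT (zero_lt_one' ℝ)] with r hr
  have hmaps : ∀ ζ ∈ closedBall (0 : ℂ) 1, (r : ℂ) * ζ ∈ ball (0 : ℂ) 1 := by
    intro ζ hζ
    have hζ : ‖ζ‖ ≤ 1 := by simpa using hζ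
    rw [mem_ball_zero_iff, norm_mul, Complex.norm_real, Real.norm_of_nonneg hr.1.le]
    nlinarith [hr.1, hr.2]
  refine pick_nonneg_of_diffContOnCl (g := fun ζ => g (r * ζ)) ?_ ?_ s u c hu
  · refine DifferentiableOn.diffContOnCl ?_
    rw [closure_ball _ one_ne_zero]
    exact hg.comp (by fun_prop) hmaps
  · exact fun ζ hζ => hg1 _ (hmaps ζ (sphere_subset_closedBall hζ))

end PickMatrix

section Factorization

open Metric Topology

theorem isPosKernel_of_factorization {φ G : ℂ → ℂ} (hφ : MapsTo φ (ball 0 1) (ball 0 1))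
    (hG : DifferentiableOn ℂ G (ball 0 1)) (hG1 : ∀ ζ ∈ ball (0 : ℂ) 1, ‖G ζ‖ ≤ 1)
    (hfac : ∀ z ∈ ball (0 : ℂ) 1, z * G (φ z) = φ z) :
    IsPosKernel fun z w => (z * conj w - φ z * conj (φ w)) / (1 - φ z * conj (φ w)) := by
  refine ⟨fun z _ w _ => ?_, fun n lam hlam c => ?_⟩
  · simp only [map_div₀, map_sub, map_mul, map_one, Complex.conj_conj]
    rw [mul_comm z, mul_comm (φ z)]
  · refine (pick_nonneg hG hG1 Finset.univ (fun i => φ (lam i)) (fun i => c i * lam i)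
      fun i _ => mem_ball_zero_iff.1 (hφ (hlam i))).trans_eq (congrArg _ ?_)
    refine Finset.sum_congr rfl fun i _ => Finset.sum_congr rfl fun j _ => ?_
    have e : lam i * conj (lam j) - φ (lam i) * conj (φ (lam j)) =
        lam i * conj (lam j) * (1 - G (φ (lam i)) * conj (G (φ (lam j)))) := by
      have h1 := hfac _ (hlam i)
      have h2 := congrArg conj (hfac _ (hlam j))
      rw [map_mul] at h2
      linear_combination (conj (lam j) * conj (G (φ (lam j)))) * h1 + φ (lam i) * h2
    simp only [e, map_mul]
    ring

theorem exists_pow_interpolation_of_isPosKernel {φ : ℂ → ℂ} (hφ : MapsTo φ (ball 0 1) (ball 0 1))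
    (hK : IsPosKernel fun z w => (z * conj w - φ z * conj (φ w)) / (1 - φ z * conj (φ w)))
    (n : ℕ) :
    ∃ F : ℂ → ℂ, DifferentiableOn ℂ F (ball 0 1) ∧
      (∀ z ∈ ball (0 : ℂ) 1, z ≠ 0 → F (φ z) = (φ z / z) ^ n) ∧
      ∀ z ∈ ball (0 : ℂ) 1, ‖F z‖ ^ 2 * (1 - ‖z‖ ^ 2) ≤ 1 := by
  obtain ⟨F, hF, hFφ, hFn⟩ := exists_interpolation_pow
    (ι := {z : ℂ // z ∈ ball (0 : ℂ) 1 ∧ z ≠ 0}) (fun z => ⟨φ z, hφ z.2.1⟩)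
    (fun z => φ z / z) (fun s c => by
      refine (hK.finset_sum_nonneg s (fun z => (z : ℂ)) (fun z _ => z.2.1)
        fun z => c z / z).trans_eq (congrArg _ ?_)
      refine Finset.sum_congr rfl fun i _ => Finset.sum_congr rfl fun j _ => ?_
      have hi : (i : ℂ) ≠ 0 := i.2.2
      have hj : conj (j : ℂ) ≠ 0 := by simpa using j.2.2
      have hij := one_sub_mul_ne_zero (mem_ball_zero_iff.1 (hφ i.2.1))
        (show ‖conj (φ j)‖ ≤ 1 by simpa using (mem_ball_zero_iff.1 (hφ j.2.1)).le)
      simp only [map_div₀]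
      field_simp) n
  exact ⟨F, hF, fun z hz hz0 => hFφ ⟨z, hz, hz0⟩, hFn⟩

theorem exists_factorization_of_isPosKernel {φ : ℂ → ℂ} (hφd : DifferentiableOn ℂ φ (ball 0 1))
    (hφ : MapsTo φ (ball 0 1) (ball 0 1)) (hφ0 : φ 0 = 0)
    (hφnc : ∃ z ∈ ball (0 : ℂ) 1, φ z ≠ 0)
    (hK : IsPosKernel fun z w => (z * conj w - φ z * conj (φ w)) / (1 - φ z * conj (φ w))) :
    ∃ G : ℂ → ℂ, DifferentiableOn ℂ G (ball 0 1) ∧ (∀ ζ ∈ ball (0 : ℂ) 1, ‖G ζ‖ ≤ 1) ∧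
      (∀ z ∈ ball (0 : ℂ) 1, z * G (φ z) = φ z) ∧ ∀ z ∈ ball (0 : ℂ) 1, G (φ z) ≠ 0 := by
  have h0 : (0 : ℂ) ∈ ball (0 : ℂ) 1 := by simp
  have hnhds : ball (0 : ℂ) 1 ∈ 𝓝 (0 : ℂ) := isOpen_ball.mem_nhds h0
  have hpre : IsPreconnected (ball (0 : ℂ) 1) := (convex_ball _ _).isPreconnected
  choose F hFd hFφ hFn using fun n => exists_pow_interpolation_of_isPosKernel hφ hK n
  have hφan := hφd.analyticOnNhd isOpen_ball
  have hne : ∀ᶠ z in 𝓝[≠] (0 : ℂ), φ z ≠ 0 := by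
    refine (hφan 0 h0).eventually_eq_zero_or_eventually_ne_zero.resolve_left fun h => ?_
    obtain ⟨z, hz, hz0⟩ := hφnc
    exact hz0 (hφan.eqOn_zero_of_preconnected_of_eventuallyEq_zero hpre h0 h hz)
  have htend : Tendsto φ (𝓝[≠] 0) (𝓝[≠] 0) := by
    refine tendsto_nhdsWithin_iff.2 ⟨?_, hne⟩
    have := (hφan 0 h0).continuousAt.tendsto
    rw [hφ0] at this
    exact this.mono_left nhdsWithin_le_nhds
  have hdisk : ∀ᶠ z in 𝓝[≠] (0 : ℂ), z ∈ ball (0 : ℂ) 1 ∧ z ≠ 0 :=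
    inter_mem (nhdsWithin_le_nhds hnhds) self_mem_nhdsWithin
  have hpow : ∀ n, EqOn (F n) (fun ζ => F 1 ζ ^ n) (ball 0 1) := by
    intro n
    refine AnalyticOnNhd.eqOn_of_preconnected_of_frequently_eq
      ((hFd n).analyticOnNhd isOpen_ball)
      (DifferentiableOn.analyticOnNhd ((hFd 1).pow n) isOpen_ball) hpre h0 ?_
    refine htend.frequently (Eventually.frequently ?_)
    filter_upwards [hdisk] with z hz
    rw [hFφ n z hz.1 hz.2, hFφ 1 z hz.1 hz.2, pow_one]
  have hF0 : F 1 0 ≠ 0 := by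
    intro hF0
    have hO := ((hFd 1).differentiableAt hnhds).isBigO_sub
    simp only [hF0, sub_zero] at hO
    obtain ⟨C, hC⟩ := hO.bound
    have hC' := (htend.mono_right nhdsWithin_le_nhds).eventually hC
    have hsmall : ∀ᶠ z in 𝓝[≠] (0 : ℂ), C * ‖z‖ < 1 := by
      have : Tendsto (fun z : ℂ => C * ‖z‖) (𝓝 0) (𝓝 0) := by
        have : Continuous fun z : ℂ => C * ‖z‖ := by fun_prop
        simpa using this.tendsto 0
      exact nhdsWithin_le_nhds (this.eventually_lt_const one_pos)
    obtain ⟨z, ⟨⟨hz1, hz2⟩, hz3⟩, hz4, hz5⟩ := ((hdisk.and hne).and (hC'.and hsmall)).exists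
    rw [hFφ 1 z hz1 hz2, pow_one, norm_div, div_le_iff₀ (norm_pos_iff.2 hz2)] at hz4
    have := norm_pos_iff.2 hz3
    nlinarith
  have hfac : ∀ z ∈ ball (0 : ℂ) 1, z * F 1 (φ z) = φ z := by
    intro z hz
    rcases eq_or_ne z 0 with rfl | hz0
    · simp [hφ0]
    · rw [hFφ 1 z hz hz0, pow_one, mul_div_cancel₀ _ hz0]
  refine ⟨F 1, hFd 1, fun ζ hζ => ?_, hfac, fun z hz hz0 => ?_⟩
  · by_contra! hlt
    have hζ1 : 0 < 1 - ‖ζ‖ ^ 2 := by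
      have : ‖ζ‖ < 1 := by simpa using hζ
      nlinarith [norm_nonneg ζ]
    obtain ⟨n, hn⟩ := pow_unbounded_of_one_lt (1 - ‖ζ‖ ^ 2)⁻¹ hlt
    have h1 := hFn n ζ hζ
    rw [hpow n hζ, norm_pow] at h1
    rw [inv_lt_iff_one_lt_mul₀ hζ1] at hn
    have h2 : 1 ≤ ‖F 1 ζ‖ ^ n := one_le_pow₀ hlt.le
    nlinarith [mul_nonneg hζ1.le (sub_nonneg.2 h2)]
  · have hφz : φ z = 0 := by rw [← hfac z hz, hz0, mul_zero]
    rw [hφz] at hz0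
    exact hF0 hz0

end Factorization

section Moebius

open Metric

theorem normSq_one_sub_sub_normSq_sub (a w : ℂ) :
    Complex.normSq (1 - conj a * w) - Complex.normSq (w - a) =
      (1 - Complex.normSq a) * (1 - Complex.normSq w) := by
  simp only [Complex.normSq_apply, Complex.sub_re, Complex.sub_im, Complex.mul_re,
    Complex.mul_im, Complex.conj_re, Complex.conj_im, Complex.one_re, Complex.one_im]
  ring

theorem norm_moebius_lt_one {a w : ℂ} (ha : ‖a‖ < 1) (hw : ‖w‖ < 1) :
    ‖(w - a) / (1 - conj a * w)‖ < 1 := by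
  have h0 : 1 - conj a * w ≠ 0 := one_sub_mul_ne_zero (by simpa using ha) hw.le
  rw [norm_div, div_lt_one (norm_pos_iff.2 h0)]
  have h := normSq_one_sub_sub_normSq_sub a w
  simp only [Complex.normSq_eq_norm_sq] at h
  refine lt_of_pow_lt_pow_left₀ 2 (norm_nonneg _) ?_
  have : 0 < (1 - ‖a‖ ^ 2) * (1 - ‖w‖ ^ 2) :=
    mul_pos (by nlinarith [norm_nonneg a]) (by nlinarith [norm_nonneg w])
  linarith

theorem dbrKernel_ratio_eq (b : ℂ → ℂ) {z w : ℂ} (hz : ‖z‖ < 1) (hw : ‖w‖ < 1)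
    (h0 : ‖b 0‖ < 1) (hbz : ‖b z‖ < 1) (hbw : ‖b w‖ < 1) :
    1 - dbrKernel b z 0 * dbrKernel b 0 w / (dbrKernel b 0 0 * dbrKernel b z w) =
      (z * conj w - (b z - b 0) / (1 - conj (b 0) * b z) *
        conj ((b w - b 0) / (1 - conj (b 0) * b w))) /
      (1 - (b z - b 0) / (1 - conj (b 0) * b z) *
        conj ((b w - b 0) / (1 - conj (b 0) * b w))) := by
  have e1 : 1 - conj (b 0) * b z ≠ 0 := one_sub_mul_ne_zero (by simpa using h0) hbz.le
  have e2 : 1 - b 0 * conj (b w) ≠ 0 := one_sub_mul_ne_zero h0 (by simpa using hbw.le)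
  have e3 : 1 - conj (b 0) * b 0 ≠ 0 := one_sub_mul_ne_zero (by simpa using h0) h0.le
  have e4 : 1 - conj (b w) * b z ≠ 0 := one_sub_mul_ne_zero (by simpa using hbw) hbz.le
  have e5 : 1 - conj w * z ≠ 0 := one_sub_mul_ne_zero (by simpa using hw) hz.le
  have e : 1 - (b z - b 0) / (1 - conj (b 0) * b z) *
      conj ((b w - b 0) / (1 - conj (b 0) * b w)) =
      (1 - conj (b 0) * b 0) * (1 - conj (b w) * b z) /
        ((1 - conj (b 0) * b z) * (1 - b 0 * conj (b w))) := by
    simp only [map_div₀, map_sub, map_mul, map_one, Complex.conj_conj]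
    rw [div_mul_div_comm, one_sub_div (mul_ne_zero e1 e2)]
    congr 1
    ring
  have e' : (b z - b 0) / (1 - conj (b 0) * b z) *
      conj ((b w - b 0) / (1 - conj (b 0) * b w)) =
      1 - (1 - conj (b 0) * b 0) * (1 - conj (b w) * b z) /
        ((1 - conj (b 0) * b z) * (1 - b 0 * conj (b w))) := by
    rw [← e, sub_sub_cancel]
  rw [e, e']
  simp only [dbrKernel, map_zero, zero_mul, sub_zero, div_one, mul_zero]
  rw [mul_comm (conj (b w)) (b 0), show z * conj w = 1 - (1 - conj w * z) by ring]
  generalize 1 - conj (b 0) * b z = P at e1 ⊢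
  generalize 1 - b 0 * conj (b w) = Q at e2 ⊢
  generalize 1 - conj (b 0) * b 0 = R at e3 ⊢
  generalize 1 - conj (b w) * b z = S at e4 ⊢
  generalize 1 - conj w * z = T at e5 ⊢
  field_simp
  ring

theorem norm_lt_one_of_nonconst {b : ℂ → ℂ} (hb : MemBallHinf b) (hnc : NonconstOnDisk b)
    {z : ℂ} (hz : z ∈ unitDisk) : ‖b z‖ < 1 := by
  refine lt_of_le_of_ne (hb.2 z hz) fun h1 => ?_
  obtain ⟨x, hx, y, hy, hxy⟩ := hnc
  have h := Complex.eqOn_of_isPreconnected_of_isMaxOn_norm (f := b) (U := unitDisk) (c := z)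
    (convex_ball _ _).isPreconnected isOpen_ball hb.1 hz fun w hw => by
      simpa [h1] using hb.2 w hw
  exact hxy ((h hx).trans (h hy).symm)

end Moebius

/-- `H(b)` has the complete Nevanlinna–Pick property iff there is a
holomorphic function `h` on `b(𝔻)` with `h ∘ b = id` on `𝔻`, such that
`z ↦ (z - b 0)/h z` extends holomorphically to `𝔻` with
`|(z - b 0)/h z| ≤ |1 - conj (b 0) * z|` on `𝔻`. -/
theorem deBrangesRovnyak_CNP_iff (b : ℂ → ℂ) (hb : MemBallHinf b)
    (hnc : NonconstOnDisk b) :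
    HasCNP b ↔
      ∃ h : ℂ → ℂ, DifferentiableOn ℂ h (b '' unitDisk) ∧
        (∀ z ∈ unitDisk, h (b z) = z) ∧
        ∃ g : ℂ → ℂ, DifferentiableOn ℂ g unitDisk ∧
          (∀ z ∈ b '' unitDisk, h z ≠ 0 → g z = (z - b 0) / h z) ∧
          ∀ z ∈ unitDisk, ‖g z‖ ≤ ‖1 - starRingEnd ℂ (b 0) * z‖ := by
  set a := b 0 with ha
  have h0 : (0 : ℂ) ∈ unitDisk := by simp [unitDisk]
  have hb1 : ∀ z ∈ unitDisk, ‖b z‖ < 1 := fun z hz => norm_lt_one_of_nonconst hb hnc hz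
  have ha1 : ‖a‖ < 1 := hb1 0 h0
  have hden : ∀ w : ℂ, ‖w‖ < 1 → 1 - conj a * w ≠ 0 := fun w hw =>
    one_sub_mul_ne_zero (by simpa using ha1) hw.le
  set τ : ℂ → ℂ := fun w => (w - a) / (1 - conj a * w) with hτ
  have hτd : DifferentiableOn ℂ τ unitDisk := by
    refine DifferentiableOn.fun_div (by fun_prop) (by fun_prop) fun w hw => ?_
    exact hden w (mem_ball_zero_iff.1 hw)
  have hτm : MapsTo τ unitDisk unitDisk := fun w hw =>
    mem_ball_zero_iff.2 (norm_moebius_lt_one ha1 (mem_ball_zero_iff.1 hw))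
  have hbm : MapsTo b unitDisk unitDisk := fun z hz => mem_ball_zero_iff.2 (hb1 z hz)
  have hφm : MapsTo (fun z => τ (b z)) unitDisk unitDisk := hτm.comp hbm
  have hker : ∀ z ∈ unitDisk, ∀ w ∈ unitDisk,
      1 - dbrKernel b z 0 * dbrKernel b 0 w / (dbrKernel b 0 0 * dbrKernel b z w) =
        (z * conj w - τ (b z) * conj (τ (b w))) / (1 - τ (b z) * conj (τ (b w))) :=
    fun z hz w hw => dbrKernel_ratio_eq b (mem_ball_zero_iff.1 hz) (mem_ball_zero_iff.1 hw)
      ha1 (hb1 z hz) (hb1 w hw)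
  constructor
  · rintro ⟨-, hK⟩
    obtain ⟨G, hGd, hG1, hfac, hG0⟩ := exists_factorization_of_isPosKernel
      (φ := fun z => τ (b z)) (hτd.comp hb.1 hbm) hφm (by simp [hτ, ha]) (by
        by_contra! hall
        obtain ⟨x, hx, y, hy, hxy⟩ := hnc
        have hconst : ∀ z ∈ unitDisk, b z = a := fun z hz =>
          sub_eq_zero.1 ((div_eq_zero_iff.1 (hall z hz)).resolve_right (hden _ (hb1 z hz)))
        exact hxy ((hconst x hx).trans (hconst y hy).symm))
      (hK.congr hker)
    have himg : b '' unitDisk ⊆ unitDisk := hbm.image_subset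
    refine ⟨fun v => τ v / G (τ v), ?_, fun z hz => ?_, fun v => G (τ v) * (1 - conj a * v),
      ?_, ?_, fun v hv => ?_⟩
    · refine DifferentiableOn.fun_div (hτd.mono himg)
        ((hGd.comp hτd hτm).mono himg) ?_
      rintro _ ⟨z, hz, rfl⟩
      exact hG0 z hz
    · rw [div_eq_iff (hG0 z hz)]
      exact (hfac z hz).symm
    · exact (hGd.comp hτd hτm).mul (by fun_prop)
    · rintro _ ⟨z, hz, rfl⟩ hne
      have hG := hG0 z hz
      have hd := hden _ (hb1 z hz)
      have hn : τ (b z) ≠ 0 := fun h => hne (by simp [h])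
      have hv : b z - a = τ (b z) * (1 - conj a * b z) := (div_mul_cancel₀ _ hd).symm
      simp only at hG ⊢
      rw [hv]
      field_simp
    · rw [norm_mul]
      exact mul_le_of_le_one_left (norm_nonneg _) (hG1 _ (hτm hv))
  · rintro ⟨h, -, hhb, g, hgd, hgh, hgn⟩
    refine ⟨fun z hz w hw => ?_, ?_⟩
    · refine div_ne_zero (one_sub_mul_ne_zero ?_ (hb1 z hz).le) (one_sub_mul_ne_zero ?_ ?_)
      · simpa using hb1 w hw
      · simpa using mem_ball_zero_iff.1 hw
      · exact (mem_ball_zero_iff.1 hz).le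
    have hden' : ∀ w : ℂ, ‖w‖ < 1 → 1 + conj a * w ≠ 0 := fun w hw => by
      simpa using one_sub_mul_ne_zero (x := conj (-a)) (by simpa using ha1) hw.le
    set σ : ℂ → ℂ := fun u => (u + a) / (1 + conj a * u) with hσ
    have hσm : MapsTo σ unitDisk unitDisk := fun u hu => by
      have := norm_moebius_lt_one (a := -a) (by simpa using ha1) (mem_ball_zero_iff.1 hu)
      exact mem_ball_zero_iff.2 (by simpa [hσ] using this)
    have hσd : DifferentiableOn ℂ σ unitDisk := by
      refine DifferentiableOn.fun_div (by fun_prop) (by fun_prop) fun w hw => ?_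
      exact hden' w (mem_ball_zero_iff.1 hw)
    have hστ : ∀ w ∈ unitDisk, σ (τ w) = w := by
      intro w hw
      have h1 := hden w (mem_ball_zero_iff.1 hw)
      have h2 := hden' _ (mem_ball_zero_iff.1 (hτm hw))
      have h3 : τ w * (1 - conj a * w) = w - a := div_mul_cancel₀ _ h1
      rw [hσ]
      simp only
      rw [div_eq_iff h2]
      linear_combination h3
    refine (isPosKernel_of_factorization (φ := fun z => τ (b z))
      (G := fun u => g (σ u) / (1 - conj a * σ u)) hφm ?_ ?_ ?_).congr
      fun z hz w hw => (hker z hz w hw).symm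
    · refine DifferentiableOn.fun_div (hgd.comp hσd hσm)
        (DifferentiableOn.const_sub (hσd.const_mul _) _) fun u hu => ?_
      exact hden _ (mem_ball_zero_iff.1 (hσm hu))
    · intro u hu
      rw [norm_div]
      exact div_le_one_of_le₀ (hgn _ (hσm hu)) (norm_nonneg _)
    · intro z hz
      simp only [hστ _ (hbm hz)]
      rcases eq_or_ne z 0 with rfl | hz0
      · simp [hτ, ha]
      · have hg := hgh (b z) ⟨z, hz, rfl⟩ (by rwa [hhb z hz])
        rw [hg, hhb z hz, hτ]
        have := hden _ (hb1 z hz)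
        field_simp
end
end

section
/- Let b be a nonconstant element of the closed unit ball H∞₁ of the bounded holomorphic functions on the open unit disk 𝔻, and suppose H(b) has the complete Nevanlinna–Pick property. Then there exists a holomorphic function h on b(𝔻) with h(b(z)) = z for all z ∈ 𝔻, and the function z ↦ (z − b(0))/h(z) extends to a holomorphic function on all of 𝔻 satisfying |(z − b(0))/h(z)| ≤ |1 − conj(b(0))·z| for all z ∈ 𝔻. -/
open Complex Set Filter MeasureTheory

noncomputable section

open Topology InnerProductSpace

/-- The Hardy space `H²`, as the space of square summable Taylor coefficient sequences. -/
abbrev HardySpace : Type := lp (fun _ : ℕ => ℂ) 2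

namespace HardySpace

lemma memlp_szego {ζ : ℂ} (hζ : ‖ζ‖ < 1) :
    Memℓp (fun n : ℕ => starRingEnd ℂ ζ ^ n) 2 := by
  refine memℓp_gen ?_
  have h : Summable fun n : ℕ => (‖ζ‖ ^ 2) ^ n :=
    summable_geometric_of_lt_one (by positivity) (by nlinarith [norm_nonneg ζ])
  refine h.congr fun n => ?_
  simp [← pow_mul, mul_comm]

open Classical in
/-- The Szegő kernel function at `ζ`, reproducing the value at `ζ` when `‖ζ‖ < 1`. -/
def szego (ζ : ℂ) : HardySpace :=
  if h : ‖ζ‖ < 1 then ⟨fun n => starRingEnd ℂ ζ ^ n, memlp_szego h⟩ else 0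

lemma szego_apply {ζ : ℂ} (hζ : ‖ζ‖ < 1) (n : ℕ) : szego ζ n = starRingEnd ℂ ζ ^ n := by
  simp [szego, hζ]

lemma hasSum_inner_szego {ζ : ℂ} (hζ : ‖ζ‖ < 1) (f : HardySpace) :
    HasSum (fun n => f n * ζ ^ n) ⟪szego ζ, f⟫_ℂ := by
  refine (lp.hasSum_inner (𝕜 := ℂ) (szego ζ) f).congr_fun fun n => ?_
  simp [szego_apply hζ]

lemma inner_szego_szego {ζ ω : ℂ} (hζ : ‖ζ‖ < 1) (hω : ‖ω‖ < 1) :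
    ⟪szego ζ, szego ω⟫_ℂ = (1 - ζ * starRingEnd ℂ ω)⁻¹ := by
  refine (hasSum_inner_szego hζ _).unique ?_
  have h : ‖ζ * starRingEnd ℂ ω‖ < 1 := by
    rw [norm_mul, RCLike.norm_conj]
    nlinarith [norm_nonneg ζ, norm_nonneg ω]
  refine (hasSum_geometric_of_norm_lt_one h).congr_fun fun n => ?_
  rw [szego_apply hω, mul_pow, mul_comm]

lemma hasFPowerSeriesOnBall (f : HardySpace) :
    HasFPowerSeriesOnBall (fun ζ => ⟪szego ζ, f⟫_ℂ) (.ofScalars ℂ (f : ℕ → ℂ)) 0 1 where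
  r_le := by
    refine FormalMultilinearSeries.le_radius_of_bound (r := 1) _ ‖f‖ fun n => ?_
    simpa [FormalMultilinearSeries.ofScalars_norm] using lp.norm_apply_le_norm (by simp) f n
  r_pos := one_pos
  hasSum := by
    intro y hy
    have hy : ‖y‖ < 1 := by simpa [← ofReal_norm, ENNReal.ofReal_lt_one] using hy
    simpa [FormalMultilinearSeries.ofScalars_apply_eq, mul_comm] using hasSum_inner_szego hy f

lemma analyticOnNhd (f : HardySpace) :
    AnalyticOnNhd ℂ (fun ζ => ⟪szego ζ, f⟫_ℂ) (Metric.ball 0 1) := by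
  have := (hasFPowerSeriesOnBall f).analyticOnNhd
  rwa [← ENNReal.ofReal_one, Metric.eball_ofReal] at this

lemma eq_zero_of_frequently {f : HardySpace} (hf : ∃ᶠ ζ in 𝓝[≠] 0, ⟪szego ζ, f⟫_ℂ = 0) :
    f = 0 := by
  have h := (((analyticOnNhd f) 0 (by simp)).frequently_zero_iff_eventually_zero).1 hf
  have hp := ((hasFPowerSeriesOnBall f).hasFPowerSeriesAt.congr h).eq_zero
  rw [FormalMultilinearSeries.ofScalars_series_eq_zero] at hp
  ext n
  simp [hp]

end HardySpace

open HardySpace in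
/-- **Nevanlinna–Pick interpolation** on a set of nodes accumulating at the origin. -/
theorem exists_schur_interpolant {ι : Type*} (x u : ι → ℂ) (hx : ∀ i, ‖x i‖ < 1)
    (hfreq : ∃ᶠ ζ in 𝓝[≠] 0, ζ ∈ range x)
    (hpos : ∀ (s : Finset ι) (c : ι → ℂ), 0 ≤ (∑ i ∈ s, ∑ j ∈ s, c i * starRingEnd ℂ (c j) *
      ((1 - u i * starRingEnd ℂ (u j)) / (1 - x i * starRingEnd ℂ (x j)))).re) :
    ∃ ψ : ℂ → ℂ, DifferentiableOn ℂ ψ (Metric.ball 0 1) ∧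
      (∀ ζ ∈ Metric.ball (0 : ℂ) 1, ‖ψ ζ‖ ≤ 1) ∧ ∀ i, ψ (x i) = u i := by
  set e : (ι →₀ ℂ) →ₗ[ℂ] HardySpace := Finsupp.linearCombination ℂ fun i => szego (x i)
  set m : (ι →₀ ℂ) →ₗ[ℂ] HardySpace :=
    Finsupp.linearCombination ℂ fun i => starRingEnd ℂ (u i) • szego (x i)
  have hdense : DenseRange e := by
    change Dense (LinearMap.range e : Set HardySpace)
    rw [Submodule.dense_iff_topologicalClosure_eq_top, Submodule.topologicalClosure_eq_top_iff,
      Submodule.eq_bot_iff]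
    intro f hf
    refine eq_zero_of_frequently (hfreq.mono ?_)
    rintro _ ⟨i, rfl⟩
    refine (Submodule.mem_orthogonal _ _).1 hf _ ⟨Finsupp.single i 1, ?_⟩
    simp [e]
  have hnorm : ∀ c, ‖m c‖ ≤ 1 * ‖e c‖ := by
    intro c
    rw [one_mul, ← sq_le_sq₀ (norm_nonneg _) (norm_nonneg _), ← inner_self_eq_norm_sq (𝕜 := ℂ),
      ← inner_self_eq_norm_sq (𝕜 := ℂ), ← sub_nonneg, ← map_sub]
    refine (hpos c.support fun i => starRingEnd ℂ (c i)).trans_eq ?_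
    simp only [e, m, Finsupp.linearCombination_apply, Finsupp.sum, sum_inner, inner_sum,
      inner_smul_left, inner_smul_right, inner_szego_szego (hx _) (hx _), Finset.mul_sum,
      ← Finset.sum_sub_distrib]
    rw [Finset.sum_comm]
    refine congrArg Complex.re ?_
    refine Finset.sum_congr rfl fun i _ => Finset.sum_congr rfl fun j _ => ?_
    simp only [Complex.conj_conj]
    ring
  set T : HardySpace →L[ℂ] HardySpace := m.extendOfNorm e
  have hT (i : ι) : T (szego (x i)) = starRingEnd ℂ (u i) • szego (x i) := by
    simpa [e, m] using
      LinearMap.extendOfNorm_eq hdense ⟨1, hnorm⟩ (Finsupp.single i 1)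
  have hTnorm : ‖T‖ ≤ 1 := LinearMap.opNorm_extendOfNorm_le hdense zero_le_one hnorm
  have hadj (f : HardySpace) (i : ι) :
      ⟪szego (x i), T.adjoint f⟫_ℂ = u i * ⟪szego (x i), f⟫_ℂ := by
    rw [ContinuousLinearMap.adjoint_inner_right, hT, inner_smul_left, Complex.conj_conj]
  set ψ : ℂ → ℂ := fun ζ => ⟪szego ζ, T.adjoint (szego 0)⟫_ℂ
  have hψ (i : ι) : ψ (x i) = u i := by
    simp [ψ, hadj, inner_szego_szego (hx i)]
  have hmul (f : HardySpace) {ζ : ℂ} (hζ : ζ ∈ Metric.ball (0 : ℂ) 1) :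
      ⟪szego ζ, T.adjoint f⟫_ℂ = ψ ζ * ⟪szego ζ, f⟫_ℂ := by
    refine (analyticOnNhd _).eqOn_of_preconnected_of_frequently_eq
      ((analyticOnNhd _).mul (analyticOnNhd f)) (convex_ball _ _).isPreconnected
      (Metric.mem_ball_self one_pos) (hfreq.mono ?_) hζ
    rintro _ ⟨i, rfl⟩
    rw [hadj, ← hψ]
  refine ⟨ψ, (analyticOnNhd _).differentiableOn, fun ζ hζ => ?_, hψ⟩
  have hζ' : ‖ζ‖ < 1 := by simpa using hζ
  have hne : szego ζ ≠ 0 := fun h => by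
    simpa [szego_apply hζ'] using congrArg (fun f : HardySpace => f 0) h
  have hle : ‖⟪szego ζ, T.adjoint (szego ζ)⟫_ℂ‖ ≤ ‖szego ζ‖ * ‖szego ζ‖ := by
    refine (norm_inner_le_norm _ _).trans ?_
    gcongr
    refine (T.adjoint.le_of_opNorm_le (c := 1) ?_ _).trans_eq (one_mul _)
    rwa [LinearIsometryEquiv.norm_map]
  rw [hmul _ hζ, norm_mul, inner_self_eq_norm_sq_to_K, norm_pow, RCLike.norm_ofReal,
    abs_norm, ← sq] at hle
  exact le_of_mul_le_mul_right (by rwa [one_mul]) (by positivity : 0 < ‖szego ζ‖ ^ 2)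

section FrostmanShift

variable {b : ℂ → ℂ}

/-- The disk automorphism sending `a` to `0`. -/
def moebius (a β : ℂ) : ℂ := (β - a) / (1 - starRingEnd ℂ a * β)

lemma one_sub_conj_mul_ne_zero {a β : ℂ} (ha : ‖a‖ < 1) (hβ : ‖β‖ < 1) :
    1 - starRingEnd ℂ a * β ≠ 0 := by
  intro h
  have h1 : ‖starRingEnd ℂ a * β‖ = 1 := by rw [← sub_eq_zero.1 h, norm_one]
  rw [norm_mul, RCLike.norm_conj] at h1
  nlinarith [norm_nonneg a, norm_nonneg β]

lemma one_sub_moebius_mul_conj {a β γ : ℂ} (ha : ‖a‖ < 1) (hβ : ‖β‖ < 1) (hγ : ‖γ‖ < 1) :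
    1 - moebius a β * starRingEnd ℂ (moebius a γ) =
      (1 - starRingEnd ℂ a * a) * (1 - starRingEnd ℂ γ * β) /
        ((1 - starRingEnd ℂ a * β) * (1 - starRingEnd ℂ γ * a)) := by
  have h1 := one_sub_conj_mul_ne_zero ha hβ
  have h2 := one_sub_conj_mul_ne_zero hγ ha
  have h3 : 1 - a * starRingEnd ℂ γ ≠ 0 := by rwa [mul_comm]
  have h4 : 1 - β * starRingEnd ℂ a ≠ 0 := by rwa [mul_comm]
  simp only [moebius, map_div₀, map_sub, map_mul, Complex.conj_conj, map_one]
  field_simp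
  ring

lemma norm_moebius_lt_one_s1 {a β : ℂ} (ha : ‖a‖ < 1) (hβ : ‖β‖ < 1) : ‖moebius a β‖ < 1 := by
  have h := one_sub_moebius_mul_conj ha hβ hβ
  have key : ((1 - ‖moebius a β‖ ^ 2 : ℝ) : ℂ) =
      (((1 - ‖a‖ ^ 2) * (1 - ‖β‖ ^ 2) / ‖1 - starRingEnd ℂ a * β‖ ^ 2 : ℝ) : ℂ) := by
    push_cast
    rw [← Complex.mul_conj', ← Complex.mul_conj', ← Complex.mul_conj', ← Complex.mul_conj', h]
    simp only [map_sub, map_mul, Complex.conj_conj, map_one]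
    ring_nf
  have key' := Complex.ofReal_injective key
  have hd : 0 < ‖1 - starRingEnd ℂ a * β‖ := norm_pos_iff.2 (one_sub_conj_mul_ne_zero ha hβ)
  have hpos : 0 < (1 - ‖a‖ ^ 2) * (1 - ‖β‖ ^ 2) / ‖1 - starRingEnd ℂ a * β‖ ^ 2 := by
    have h1 : 0 < 1 - ‖a‖ ^ 2 := by nlinarith [norm_nonneg a]
    have h2 : 0 < 1 - ‖β‖ ^ 2 := by nlinarith [norm_nonneg β]
    positivity
  nlinarith [norm_nonneg (moebius a β)]

lemma moebius_eq_zero {a β : ℂ} (ha : ‖a‖ < 1) (hβ : ‖β‖ < 1) :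
    moebius a β = 0 ↔ β = a := by
  simp [moebius, one_sub_conj_mul_ne_zero ha hβ, sub_eq_zero]

lemma differentiableOn_moebius {a : ℂ} (ha : ‖a‖ < 1) :
    DifferentiableOn ℂ (moebius a) (Metric.ball 0 1) := by
  refine DifferentiableOn.div (by fun_prop) (by fun_prop) fun β hβ => ?_
  exact one_sub_conj_mul_ne_zero ha (by simpa using hβ)

lemma MemBallHinf.norm_lt_one (hb : MemBallHinf b) (hcnp : HasCNP b) {z : ℂ}
    (hz : z ∈ unitDisk) : ‖b z‖ < 1 := by
  refine lt_of_le_of_ne (hb.2 z hz) fun h => hcnp.1 z hz z hz ?_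
  simp [dbrKernel, Complex.conj_mul', h]

/-- The complete Nevanlinna–Pick kernel of `H(b)` in terms of the Frostman shift of `b`. -/
lemma cnpKernel_eq (hb : MemBallHinf b) (hcnp : HasCNP b) {z w : ℂ}
    (hz : z ∈ unitDisk) (hw : w ∈ unitDisk) :
    1 - dbrKernel b z 0 * dbrKernel b 0 w / (dbrKernel b 0 0 * dbrKernel b z w) =
      (z * starRingEnd ℂ w - moebius (b 0) (b z) * starRingEnd ℂ (moebius (b 0) (b w))) /
        (1 - moebius (b 0) (b z) * starRingEnd ℂ (moebius (b 0) (b w))) := by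
  have h0 : ‖b 0‖ < 1 := hb.norm_lt_one hcnp (by simp [unitDisk])
  have hz' := hb.norm_lt_one hcnp hz
  have hw' := hb.norm_lt_one hcnp hw
  have h1 := one_sub_conj_mul_ne_zero h0 hz'
  have h2 := one_sub_conj_mul_ne_zero hw' h0
  have h3 := one_sub_conj_mul_ne_zero h0 h0
  have h4 := one_sub_conj_mul_ne_zero hw' hz'
  have h5 : 1 - starRingEnd ℂ w * z ≠ 0 :=
    one_sub_conj_mul_ne_zero (by simpa [unitDisk] using hw) (by simpa [unitDisk] using hz)
  have hm := one_sub_moebius_mul_conj h0 hz' hw'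
  have hm0 : 1 - moebius (b 0) (b z) * starRingEnd ℂ (moebius (b 0) (b w)) ≠ 0 := by
    rw [hm]
    exact div_ne_zero (mul_ne_zero h3 h4) (mul_ne_zero h1 h2)
  rw [eq_div_iff hm0, ← sub_eq_zero]
  have : z * starRingEnd ℂ w - moebius (b 0) (b z) * starRingEnd ℂ (moebius (b 0) (b w)) =
      (1 - moebius (b 0) (b z) * starRingEnd ℂ (moebius (b 0) (b w))) -
        (1 - starRingEnd ℂ w * z) := by ring
  rw [this, hm]
  simp only [dbrKernel, map_zero, zero_mul, mul_zero, sub_zero, div_one]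
  generalize 1 - starRingEnd ℂ (b 0) * b z = A at *
  generalize 1 - starRingEnd ℂ (b w) * b 0 = B at *
  generalize 1 - starRingEnd ℂ (b 0) * b 0 = C at *
  generalize 1 - starRingEnd ℂ (b w) * b z = D at *
  generalize 1 - starRingEnd ℂ w * z = E at *
  field_simp
  ring

lemma exists_schur_moebius (hb : MemBallHinf b) (hnc : NonconstOnDisk b) (hcnp : HasCNP b) :
    ∃ ψ : ℂ → ℂ, DifferentiableOn ℂ ψ (Metric.ball 0 1) ∧
      (∀ ζ ∈ Metric.ball (0 : ℂ) 1, ‖ψ ζ‖ ≤ 1) ∧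
      ∀ z ∈ unitDisk, z ≠ 0 → ψ (moebius (b 0) (b z)) = moebius (b 0) (b z) / z := by
  have hlt {z : ℂ} (hz : z ∈ unitDisk) : ‖b z‖ < 1 := hb.norm_lt_one hcnp hz
  have h0mem : (0 : ℂ) ∈ unitDisk := by simp [unitDisk]
  have h0 := hlt h0mem
  have hφ {z : ℂ} (hz : z ∈ unitDisk) := norm_moebius_lt_one_s1 h0 (hlt hz)
  have hbAn : AnalyticOnNhd ℂ b unitDisk := hb.1.analyticOnNhd Metric.isOpen_ball
  have hnhds : ∀ᶠ z in 𝓝[≠] (0 : ℂ), z ∈ unitDisk :=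
    mem_nhdsWithin_of_mem_nhds (Metric.ball_mem_nhds _ one_pos)
  have hne : ∀ᶠ z in 𝓝[≠] (0 : ℂ), b z ≠ b 0 := by
    by_contra h
    have heq := hbAn.eqOn_of_preconnected_of_frequently_eq (analyticOnNhd_const (v := b 0))
      (convex_ball _ _).isPreconnected h0mem h
    obtain ⟨z, hz, w, hw, hzw⟩ := hnc
    exact hzw ((heq hz).trans (heq hw).symm)
  have hcont : ContinuousAt (fun z => moebius (b 0) (b z)) 0 :=
    ((differentiableOn_moebius h0).differentiableAt
      (Metric.isOpen_ball.mem_nhds (by simpa using h0))).continuousAt.comp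
      (f := b) (hbAn 0 h0mem).continuousAt
  have htend : Tendsto (fun z => moebius (b 0) (b z)) (𝓝[≠] 0) (𝓝[≠] 0) := by
    refine tendsto_nhdsWithin_iff.2 ⟨?_, ?_⟩
    · simpa [moebius] using hcont.tendsto.mono_left nhdsWithin_le_nhds
    · filter_upwards [hne, hnhds] with z hz hzD
      simpa [moebius_eq_zero h0 (hlt hzD)] using hz
  suffices ∃ ψ : ℂ → ℂ, DifferentiableOn ℂ ψ (Metric.ball 0 1) ∧
      (∀ ζ ∈ Metric.ball (0 : ℂ) 1, ‖ψ ζ‖ ≤ 1) ∧ ∀ z : {z : ℂ // z ∈ unitDisk ∧ z ≠ 0},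
        ψ (moebius (b 0) (b z)) = moebius (b 0) (b z) / z by
    obtain ⟨ψ, hψd, hψ1, hψ⟩ := this
    exact ⟨ψ, hψd, hψ1, fun z hz hz0 => hψ ⟨z, hz, hz0⟩⟩
  refine exists_schur_interpolant _ _ (fun z => hφ z.2.1) ?_ ?_
  · refine htend.frequently (Eventually.frequently ?_)
    filter_upwards [hnhds, self_mem_nhdsWithin] with z hz hz0
    exact ⟨⟨z, hz, hz0⟩, rfl⟩
  · intro s c
    let σ := s.equivFin.symm
    refine (hcnp.2.2 s.card (fun i => (σ i : {z : ℂ // z ∈ unitDisk ∧ z ≠ 0}))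
      (fun i => (σ i).1.2.1) fun i => c (σ i) / (σ i).1.1).trans_eq (congrArg Complex.re ?_)
    rw [← Finset.sum_coe_sort s, ← Equiv.sum_comp σ]
    refine Finset.sum_congr rfl fun i _ => ?_
    rw [← Finset.sum_coe_sort s, ← Equiv.sum_comp σ]
    refine Finset.sum_congr rfl fun j _ => ?_
    have hi := (σ i).1.2
    have hj := (σ j).1.2
    have hj' : starRingEnd ℂ ((σ j).1.1) ≠ 0 := by simpa using hj.2
    have hi' := hi.2
    dsimp only
    rw [cnpKernel_eq hb hcnp hi.1 hj.1]
    simp only [map_div₀]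
    field_simp

end FrostmanShift

/-- if `H(b)` has the complete Nevanlinna–Pick property then there is
a holomorphic function `h` on `b(𝔻)` with `h ∘ b = id` on `𝔻`, such that
`z ↦ (z - b 0)/h z` extends holomorphically to `𝔻` with
`|(z - b 0)/h z| ≤ |1 - conj (b 0) * z|` on `𝔻`. -/
theorem deBrangesRovnyak_CNP_necessary (b : ℂ → ℂ) (hb : MemBallHinf b)
    (hnc : NonconstOnDisk b) (hcnp : HasCNP b) :
    ∃ h : ℂ → ℂ, DifferentiableOn ℂ h (b '' unitDisk) ∧
      (∀ z ∈ unitDisk, h (b z) = z) ∧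
      ∃ g : ℂ → ℂ, DifferentiableOn ℂ g unitDisk ∧
        (∀ z ∈ b '' unitDisk, h z ≠ 0 → g z = (z - b 0) / h z) ∧
        ∀ z ∈ unitDisk, ‖g z‖ ≤ ‖1 - starRingEnd ℂ (b 0) * z‖ := by
  obtain ⟨ψ, hψd, hψ1, hψ⟩ := exists_schur_moebius hb hnc hcnp
  have hlt {z : ℂ} (hz : z ∈ unitDisk) : ‖b z‖ < 1 := hb.norm_lt_one hcnp hz
  have h0mem : (0 : ℂ) ∈ unitDisk := by simp [unitDisk]
  have h0 := hlt h0mem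
  have hball {z : ℂ} (hz : z ∈ unitDisk) :
      moebius (b 0) (b z) ∈ Metric.ball (0 : ℂ) 1 := by
    simpa using norm_moebius_lt_one_s1 h0 (hlt hz)
  have hψ0 : ψ 0 ≠ 0 := by
    intro hψ0
    obtain ⟨w, hw, hbw⟩ : ∃ w ∈ unitDisk, b w ≠ b 0 := by
      by_contra! h
      obtain ⟨z, hz, w, hw, hzw⟩ := hnc
      exact hzw ((h z hz).trans (h w hw).symm)
    have hw0 : w ≠ 0 := by rintro rfl; exact hbw rfl
    have hle := Complex.norm_le_norm_of_mapsTo_ball hψd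
      (fun ζ hζ => by simpa using hψ1 ζ hζ) hψ0 (mem_ball_zero_iff.1 (hball hw))
    have hpos : 0 < ‖moebius (b 0) (b w)‖ :=
      norm_pos_iff.2 (mt (moebius_eq_zero h0 (hlt hw)).1 hbw)
    rw [hψ w hw hw0, norm_div, div_le_iff₀ (norm_pos_iff.2 hw0)] at hle
    have hw1 : ‖w‖ < 1 := by simpa [unitDisk] using hw
    nlinarith
  have hφ0 {z : ℂ} (hz : z ∈ unitDisk) (hz0 : z ≠ 0) : moebius (b 0) (b z) ≠ 0 := by
    intro h
    have := hψ z hz hz0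
    rw [h, zero_div] at this
    exact hψ0 this
  have hψne {z : ℂ} (hz : z ∈ unitDisk) : ψ (moebius (b 0) (b z)) ≠ 0 := by
    rcases eq_or_ne z 0 with rfl | hz0
    · simpa [moebius] using hψ0
    · rw [hψ z hz hz0]
      exact div_ne_zero (hφ0 hz hz0) hz0
  have hmaps : MapsTo (moebius (b 0)) unitDisk (Metric.ball 0 1) := fun β hβ => by
    simpa using norm_moebius_lt_one_s1 h0 (by simpa [unitDisk] using hβ)
  have hmd := differentiableOn_moebius h0
  have himage : b '' unitDisk ⊆ unitDisk := by
    rintro _ ⟨z, hz, rfl⟩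
    simpa [unitDisk] using hlt hz
  refine ⟨fun β => moebius (b 0) β / ψ (moebius (b 0) β), ?_, ?_,
    fun β => (1 - starRingEnd ℂ (b 0) * β) * ψ (moebius (b 0) β), ?_, ?_, ?_⟩
  · refine (hmd.mono himage).div ((hψd.comp hmd hmaps).mono himage) ?_
    rintro _ ⟨z, hz, rfl⟩
    exact hψne hz
  · intro z hz
    rcases eq_or_ne z 0 with rfl | hz0
    · simp [moebius]
    · simp only [hψ z hz hz0]
      exact div_div_cancel₀ (hφ0 hz hz0)
  · exact DifferentiableOn.mul (by fun_prop) (hψd.comp hmd hmaps)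
  · rintro _ ⟨z, hz, rfl⟩ hne
    have h1 := one_sub_conj_mul_ne_zero h0 (hlt hz)
    have hm := (div_ne_zero_iff.1 hne).1
    have hβ : b z - b 0 = (1 - starRingEnd ℂ (b 0) * b z) * moebius (b 0) (b z) := by
      rw [moebius, mul_div_cancel₀ _ h1]
    simp only [hβ]
    field_simp [hψne hz]
  · intro β hβ
    rw [norm_mul]
    exact mul_le_of_le_one_right (norm_nonneg _) (hψ1 _ (hmaps hβ))
end
end

section
/- Let b be a nonconstant element of the closed unit ball H∞₁ of the bounded holomorphic functions on the open unit disk 𝔻, and let a = b(0). Then H(b) has the complete Nevanlinna–Pick property if and only if for every f in the Hardy space H² there exists g ∈ H² such that (1 − conj(a)·b(z))·f(b(z)) = z·(1 − conj(a)·b(z))·g(b(z)) + f(a)·(1 − |a|²) for all z ∈ 𝔻, and ‖g‖²_{H²} + (1 − |a|²)·|f(a)|² ≤ ‖f‖²_{H²}. -/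
open Complex Set Filter MeasureTheory

noncomputable section

open scoped InnerProductSpace lp ComplexConjugate

/-- The Hardy space as a space of square-summable Taylor coefficients. -/
abbrev HardyCoeff : Type := lp (fun _ : ℕ => ℂ) 2

lemma norm_lt_one_of_mem_unitDisk (u : unitDisk) : ‖(u : ℂ)‖ < 1 :=
  mem_ball_zero_iff.mp u.2

lemma memℓp_two_iff_summable_sq (c : ℕ → ℂ) :
    Memℓp c 2 ↔ Summable fun n => ‖c n‖ ^ 2 := by
  rw [memℓp_gen_iff (by norm_num)]
  simp

lemma HardyCoeff.norm_sq_eq_tsum (F : HardyCoeff) : ‖F‖ ^ 2 = ∑' n, ‖F n‖ ^ 2 := by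
  have h := lp.norm_rpow_eq_tsum (p := 2) (by norm_num) F
  simpa using h

/-- The Szegő kernel function at `u`, given by its Taylor coefficients. -/
def szego (u : unitDisk) : HardyCoeff :=
  ⟨fun n => conj (u : ℂ) ^ n, by
    refine (memℓp_two_iff_summable_sq _).2 ?_
    have h : ∀ n : ℕ, ‖conj (u : ℂ) ^ n‖ ^ 2 = (‖(u : ℂ)‖ ^ 2) ^ n := fun n => by
      rw [norm_pow, RCLike.norm_conj, ← pow_mul, ← pow_mul, mul_comm]
    simp only [h]
    refine summable_geometric_of_lt_one (by positivity) ?_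
    have := norm_lt_one_of_mem_unitDisk u
    nlinarith [norm_nonneg (u : ℂ)]⟩

@[simp] lemma szego_apply (u : unitDisk) (n : ℕ) : szego u n = conj (u : ℂ) ^ n := rfl

lemma hasSum_inner_szego (u : unitDisk) (F : HardyCoeff) :
    HasSum (fun n => F n * (u : ℂ) ^ n) (⟪szego u, F⟫_ℂ) := by
  have h := lp.hasSum_inner (𝕜 := ℂ) (szego u) F
  simpa [RCLike.inner_apply] using h

lemma inner_szego_szego (u v : unitDisk) :
    ⟪szego u, szego v⟫_ℂ = (1 - (u : ℂ) * conj (v : ℂ))⁻¹ := by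
  have h := hasSum_inner_szego u (szego v)
  simp only [szego_apply, ← mul_pow] at h
  have h2 := hasSum_geometric_of_norm_lt_one (ξ := conj (v : ℂ) * u) (by
    rw [norm_mul, RCLike.norm_conj]
    nlinarith [norm_lt_one_of_mem_unitDisk u, norm_lt_one_of_mem_unitDisk v,
      norm_nonneg (u : ℂ), norm_nonneg (v : ℂ)])
  rw [h.unique h2, mul_comm]

lemma MemH2.exists_coeff {f : ℂ → ℂ} {c : ℕ → ℂ} (h : MemH2 f c) :
    ∃ F : HardyCoeff, (∀ u : unitDisk, f u = ⟪szego u, F⟫_ℂ) ∧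
      ‖F‖ ^ 2 = ∑' n, ‖c n‖ ^ 2 := by
  refine ⟨⟨c, (memℓp_two_iff_summable_sq c).2 h.2⟩, fun u => ?_, ?_⟩
  · exact (h.1 u u.2).unique (hasSum_inner_szego u _)
  · rw [HardyCoeff.norm_sq_eq_tsum]

lemma memH2_of_coeff (F : HardyCoeff) : MemH2 (fun u => ∑' n, F n * u ^ n) F :=
  ⟨fun u hu => (hasSum_inner_szego ⟨u, hu⟩ F).summable.hasSum,
    (memℓp_two_iff_summable_sq _).1 F.2⟩

lemma tsum_eq_inner_szego (F : HardyCoeff) (u : unitDisk) :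
    ∑' n, F n * (u : ℂ) ^ n = ⟪szego u, F⟫_ℂ :=
  (hasSum_inner_szego u F).tsum_eq

/-- The component of `F` orthogonal to the Szegő kernel at `a`. -/
def szegoCompl (a : unitDisk) (F : HardyCoeff) : HardyCoeff :=
  F - (((1 - ‖(a : ℂ)‖ ^ 2 : ℝ) : ℂ) * ⟪szego a, F⟫_ℂ) • szego a

lemma one_sub_norm_sq_pos (a : unitDisk) : 0 < 1 - ‖(a : ℂ)‖ ^ 2 := by
  nlinarith [norm_lt_one_of_mem_unitDisk a, norm_nonneg (a : ℂ)]

lemma one_sub_mul_conj_ne_zero (u v : unitDisk) : 1 - (u : ℂ) * conj (v : ℂ) ≠ 0 := by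
  intro h
  have h1 : (u : ℂ) * conj (v : ℂ) = 1 := (sub_eq_zero.mp h).symm
  have h2 := congrArg norm h1
  rw [norm_mul, RCLike.norm_conj, norm_one] at h2
  nlinarith [norm_lt_one_of_mem_unitDisk u, norm_lt_one_of_mem_unitDisk v,
      norm_nonneg (u : ℂ), norm_nonneg (v : ℂ)]

lemma inner_szego_self (a : unitDisk) :
    ⟪szego a, szego a⟫_ℂ = ((1 - ‖(a : ℂ)‖ ^ 2 : ℝ) : ℂ)⁻¹ := by
  rw [inner_szego_szego, Complex.mul_conj']
  push_cast
  rfl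

lemma inner_szego_szegoCompl_self (a : unitDisk) (F : HardyCoeff) :
    ⟪szego a, szegoCompl a F⟫_ℂ = 0 := by
  have h : ((1 - ‖(a : ℂ)‖ ^ 2 : ℝ) : ℂ) ≠ 0 :=
    Complex.ofReal_ne_zero.2 (one_sub_norm_sq_pos a).ne'
  rw [szegoCompl, inner_sub_right, inner_smul_right, inner_szego_self]
  field_simp
  ring

lemma inner_szego_szegoCompl (a u : unitDisk) (F : HardyCoeff) :
    ⟪szego u, szegoCompl a F⟫_ℂ = ⟪szego u, F⟫_ℂ -
      ((1 - ‖(a : ℂ)‖ ^ 2 : ℝ) : ℂ) * ⟪szego a, F⟫_ℂ * (1 - (u : ℂ) * conj (a : ℂ))⁻¹ := by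
  rw [szegoCompl, inner_sub_right, inner_smul_right, inner_szego_szego]

lemma inner_szegoCompl_right {a : unitDisk} {G : HardyCoeff} (hG : ⟪szego a, G⟫_ℂ = 0)
    (F : HardyCoeff) : ⟪G, szegoCompl a F⟫_ℂ = ⟪G, F⟫_ℂ := by
  rw [szegoCompl, inner_sub_right, inner_smul_right, ← inner_conj_symm G (szego a), hG]
  simp

lemma norm_szegoCompl_sq (a : unitDisk) (F : HardyCoeff) :
    ‖szegoCompl a F‖ ^ 2 = ‖F‖ ^ 2 - (1 - ‖(a : ℂ)‖ ^ 2) * ‖⟪szego a, F⟫_ℂ‖ ^ 2 := by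
  have h : ((‖szegoCompl a F‖ ^ 2 : ℝ) : ℂ) =
      ((‖F‖ ^ 2 - (1 - ‖(a : ℂ)‖ ^ 2) * ‖⟪szego a, F⟫_ℂ‖ ^ 2 : ℝ) : ℂ) := by
    have h1 := inner_self_eq_norm_sq_to_K (𝕜 := ℂ) (szegoCompl a F)
    rw [inner_szegoCompl_right (inner_szego_szegoCompl_self a F), szegoCompl, inner_sub_left,
      inner_smul_left, inner_self_eq_norm_sq_to_K] at h1
    have h2 := Complex.conj_mul' (⟪szego a, F⟫_ℂ)
    push_cast
    rw [← h2, szegoCompl]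
    refine h1.symm.trans ?_
    simp
    ring
  exact_mod_cast h

/-- Douglas-type factorization: a functional dominated by `‖Y ·‖` is represented through `Y`. -/
lemma exists_inner_eq_of_norm_le {V E : Type*} [AddCommGroup V] [Module ℂ V]
    [NormedAddCommGroup E] [InnerProductSpace ℂ E] [CompleteSpace E]
    (Y : V →ₗ[ℂ] E) (φ : V →ₗ[ℂ] ℂ) (C : ℝ) (hC : 0 ≤ C) (h : ∀ c, ‖φ c‖ ≤ C * ‖Y c‖) :
    ∃ g : E, ‖g‖ ≤ C ∧ ∀ c, φ c = ⟪g, Y c⟫_ℂ := by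
  obtain ⟨s, hs⟩ := Y.rangeRestrict.exists_rightInverse_of_surjective Y.range_rangeRestrict
  have hs' : ∀ y : LinearMap.range Y, Y (s y) = y := fun y =>
    congrArg Subtype.val (LinearMap.congr_fun hs y)
  let ψ : LinearMap.range Y →L[ℂ] ℂ := (φ ∘ₗ s).mkContinuous C fun y => by
    have := h (s y)
    rw [hs'] at this
    exact this
  obtain ⟨Ψ, hΨ, hn⟩ := exists_extension_norm_eq (LinearMap.range Y) ψ
  refine ⟨(InnerProductSpace.toDual ℂ E).symm Ψ, ?_, fun c => ?_⟩
  · rw [LinearIsometryEquiv.norm_map, hn]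
    exact LinearMap.mkContinuous_norm_le _ hC _
  · rw [InnerProductSpace.toDual_symm_apply]
    have h1 := hΨ ⟨Y c, c, rfl⟩
    change Ψ (Y c) = φ (s ⟨Y c, c, rfl⟩) at h1
    rw [h1, ← sub_eq_zero, ← map_sub, ← norm_le_zero_iff]
    refine (h _).trans ?_
    rw [map_sub, hs']
    simp

lemma MemBallHinf.apply_mem_unitDisk {b : ℂ → ℂ} (hb : MemBallHinf b) (hnc : NonconstOnDisk b)
    {z : ℂ} (hz : z ∈ unitDisk) : b z ∈ unitDisk := by
  refine mem_ball_zero_iff.2 (lt_of_le_of_ne (hb.2 z hz) fun h => ?_)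
  have hmax : IsMaxOn (norm ∘ b) unitDisk z := fun w hw => by
    simpa [h] using hb.2 w hw
  have := Complex.eqOn_of_isPreconnected_of_isMaxOn_norm
    (convex_ball (0 : ℂ) 1).isPreconnected Metric.isOpen_ball hb.1 hz hmax
  obtain ⟨u, hu, v, hv, huv⟩ := hnc
  exact huv ((this hu).trans (this hv).symm)

lemma dbrKernel_ne_zero {b : ℂ → ℂ} (hb : ∀ z ∈ unitDisk, b z ∈ unitDisk) {z w : ℂ}
    (hz : z ∈ unitDisk) (hw : w ∈ unitDisk) : dbrKernel b z w ≠ 0 := by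
  have h1 := one_sub_mul_conj_ne_zero ⟨b z, hb z hz⟩ ⟨b w, hb w hw⟩
  have h2 := one_sub_mul_conj_ne_zero ⟨z, hz⟩ ⟨w, hw⟩
  rw [mul_comm] at h1 h2
  exact div_ne_zero h1 h2

/-- The kernel whose positivity is the complete Nevanlinna–Pick condition. -/
def cnpKernel (b : ℂ → ℂ) (z w : ℂ) : ℂ :=
  1 - dbrKernel b z 0 * dbrKernel b 0 w / (dbrKernel b 0 0 * dbrKernel b z w)

lemma cnpKernel_conj_symm (b : ℂ → ℂ) (z w : ℂ) :
    cnpKernel b z w = conj (cnpKernel b w z) := by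
  simp only [cnpKernel, dbrKernel, map_sub, map_mul, map_div₀, map_one, map_zero,
    Complex.conj_conj, mul_zero, zero_mul]
  rw [mul_comm (conj (b w)) (b z), mul_comm (conj (b 0)) (b z), mul_comm (conj (b w)) (b 0),
    mul_comm (conj w) z, mul_comm (conj (b 0)) (b 0)]
  ring

lemma one_sub_mul_cnpKernel {b : ℂ → ℂ} (β : unitDisk → unitDisk) (hβ : ∀ z, (β z : ℂ) = b z)
    (a : unitDisk) (ha : (a : ℂ) = b 0) (z w : unitDisk) :
    ((1 - ‖(a : ℂ)‖ ^ 2 : ℝ) : ℂ) * cnpKernel b z w =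
      (1 - b z * conj (a : ℂ)) * conj (1 - b w * conj (a : ℂ)) *
        (z * conj (w : ℂ) * ⟪szego (β z), szego (β w)⟫_ℂ - ⟪szego (β z), szego (β w)⟫_ℂ +
          ((1 - ‖(a : ℂ)‖ ^ 2 : ℝ) : ℂ) *
            (⟪szego (β z), szego a⟫_ℂ * ⟪szego a, szego (β w)⟫_ℂ)) := by
  have h1 := one_sub_mul_conj_ne_zero (β z) (β w)
  have h2 := one_sub_mul_conj_ne_zero (β z) a
  have h3 := one_sub_mul_conj_ne_zero a (β w)
  have h4 := one_sub_mul_conj_ne_zero z w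
  have h5 := one_sub_mul_conj_ne_zero a a
  have h6 : ((1 - ‖(a : ℂ)‖ ^ 2 : ℝ) : ℂ) = 1 - (a : ℂ) * conj (a : ℂ) := by
    rw [Complex.mul_conj']
    push_cast
    rfl
  rw [h6]
  simp only [inner_szego_szego, cnpKernel, dbrKernel, ← ha, ← hβ, map_sub, map_mul, map_one,
    map_zero, Complex.conj_conj, mul_zero, zero_mul, sub_zero, div_one]
  rw [mul_comm (conj (β w : ℂ)) (β z : ℂ), mul_comm (conj (a : ℂ)) (β z : ℂ),
    mul_comm (conj (β w : ℂ)) (a : ℂ), mul_comm (conj (w : ℂ)) (z : ℂ),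
    mul_comm (conj (a : ℂ)) (a : ℂ)]
  have h2' := mul_comm (β z : ℂ) (conj (a : ℂ)) ▸ h2
  field_simp
  ring

lemma ofReal_norm_sq_sum_smul {ι : Type*} (s : Finset ι) (d : ι → ℂ) (v : ι → HardyCoeff) :
    ((‖∑ i ∈ s, d i • v i‖ ^ 2 : ℝ) : ℂ) = ∑ i ∈ s, ∑ j ∈ s, conj (d i) * d j * ⟪v i, v j⟫_ℂ := by
  have h := inner_self_eq_norm_sq_to_K (𝕜 := ℂ) (∑ i ∈ s, d i • v i)
  push_cast
  refine h.symm.trans ?_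
  rw [sum_inner]
  simp only [inner_smul_left, inner_sum, inner_smul_right]
  refine Finset.sum_congr rfl fun i _ => Finset.sum_congr rfl fun j _ => by ring

lemma cnpKernel_sum_eq {b : ℂ → ℂ} (β : unitDisk → unitDisk) (hβ : ∀ z, (β z : ℂ) = b z)
    (a : unitDisk) (ha : (a : ℂ) = b 0) {ι : Type*} (s : Finset ι) (z : ι → unitDisk)
    (c d : ι → ℂ) (hd : ∀ i, conj (d i) = c i * (1 - b (z i) * conj (a : ℂ))) :
    (1 - ‖(a : ℂ)‖ ^ 2) * (∑ i ∈ s, ∑ j ∈ s, c i * conj (c j) * cnpKernel b (z i) (z j)).re =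
      ‖∑ i ∈ s, d i • conj (z i : ℂ) • szego (β (z i))‖ ^ 2 -
        ‖szegoCompl a (∑ i ∈ s, d i • szego (β (z i)))‖ ^ 2 := by
  have hd' : ∀ i, d i = conj (c i * (1 - b (z i) * conj (a : ℂ))) := fun i => by
    rw [← hd, Complex.conj_conj]
  have hA : ((‖⟪szego a, ∑ i ∈ s, d i • szego (β (z i))⟫_ℂ‖ ^ 2 : ℝ) : ℂ) =
      ∑ i ∈ s, ∑ j ∈ s, conj (d i) * d j *
        (⟪szego (β (z i)), szego a⟫_ℂ * ⟪szego a, szego (β (z j))⟫_ℂ) := by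
    push_cast
    rw [← Complex.conj_mul', inner_conj_symm]
    simp only [sum_inner, inner_sum, inner_smul_left, inner_smul_right, Finset.sum_mul_sum]
    refine Finset.sum_congr rfl fun i _ => Finset.sum_congr rfl fun j _ => by ring
  rw [← Complex.re_ofReal_mul, norm_szegoCompl_sq,
    ← Complex.ofReal_re (‖_‖ ^ 2 - (‖_‖ ^ 2 - _))]
  congr 1
  rw [Complex.ofReal_sub (‖_‖ ^ 2), Complex.ofReal_sub (‖_‖ ^ 2), Complex.ofReal_mul _ (‖_‖ ^ 2),
    hA, ofReal_norm_sq_sum_smul, ofReal_norm_sq_sum_smul]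
  simp only [Finset.mul_sum, ← Finset.sum_sub_distrib]
  refine Finset.sum_congr rfl fun i _ => Finset.sum_congr rfl fun j _ => ?_
  rw [mul_left_comm, one_sub_mul_cnpKernel β hβ a ha, hd, hd' j]
  simp only [inner_smul_left, inner_smul_right, map_mul, Complex.conj_conj]
  ring

lemma hasCNP_iff_norm_le {b : ℂ → ℂ} (β : unitDisk → unitDisk) (hβ : ∀ z, (β z : ℂ) = b z)
    (a : unitDisk) (ha : (a : ℂ) = b 0) :
    HasCNP b ↔ ∀ (n : ℕ) (z : Fin n → unitDisk) (d : Fin n → ℂ),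
      ‖szegoCompl a (∑ i, d i • szego (β (z i)))‖ ≤
        ‖∑ i, d i • conj (z i : ℂ) • szego (β (z i))‖ := by
  have hb : ∀ z ∈ unitDisk, b z ∈ unitDisk := fun z hz => hβ ⟨z, hz⟩ ▸ (β ⟨z, hz⟩).2
  have ha_pos := one_sub_norm_sq_pos a
  have hE : ∀ z : unitDisk, 1 - b z * conj (a : ℂ) ≠ 0 := fun z =>
    hβ z ▸ one_sub_mul_conj_ne_zero (β z) a
  constructor
  · intro h n z d
    have hpos := h.2.2 n (fun i => z i) (fun i => (z i).2)
      fun i => conj (d i) / (1 - b (z i) * conj (a : ℂ))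
    have heq := cnpKernel_sum_eq β hβ a ha Finset.univ z
      (fun i => conj (d i) / (1 - b (z i) * conj (a : ℂ))) d
      fun i => (div_mul_cancel₀ _ (hE (z i))).symm
    refine le_of_sq_le_sq ?_ (norm_nonneg _)
    rw [← sub_nonneg, ← heq]
    exact mul_nonneg ha_pos.le hpos
  · intro h
    refine ⟨fun z hz w hw => dbrKernel_ne_zero hb hz hw,
      fun z _ w _ => cnpKernel_conj_symm b z w, fun n lam hlam c => ?_⟩
    have heq := cnpKernel_sum_eq β hβ a ha Finset.univ (fun i => ⟨lam i, hlam i⟩) c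
      (fun i => conj (c i * (1 - b (lam i) * conj (a : ℂ))))
      fun i => Complex.conj_conj _
    refine nonneg_of_mul_nonneg_right ?_ ha_pos
    refine heq.symm ▸ sub_nonneg.2 (pow_le_pow_left₀ (norm_nonneg _) (h n _ _) 2)

lemma norm_linearCombination_le {β : unitDisk → unitDisk} {a : unitDisk}
    (h : ∀ (n : ℕ) (z : Fin n → unitDisk) (d : Fin n → ℂ),
      ‖szegoCompl a (∑ i, d i • szego (β (z i)))‖ ≤
        ‖∑ i, d i • conj (z i : ℂ) • szego (β (z i))‖) (c : unitDisk →₀ ℂ) :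
    ‖szegoCompl a (Finsupp.linearCombination ℂ (fun z => szego (β z)) c)‖ ≤
      ‖Finsupp.linearCombination ℂ (fun z : unitDisk => conj (z : ℂ) • szego (β z)) c‖ := by
  have key : ∀ v : unitDisk → HardyCoeff, Finsupp.linearCombination ℂ v c =
      ∑ i, c (c.support.equivFin.symm i) • v (c.support.equivFin.symm i) := fun v => by
    rw [Finsupp.linearCombination_apply, Finsupp.sum, ← Finset.sum_coe_sort,
      ← c.support.equivFin.symm.sum_comp]
  rw [key, key]
  exact h _ _ _

lemma exists_quotient_of_norm_le {β : unitDisk → unitDisk} {a : unitDisk}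
    (h : ∀ (n : ℕ) (z : Fin n → unitDisk) (d : Fin n → ℂ),
      ‖szegoCompl a (∑ i, d i • szego (β (z i)))‖ ≤
        ‖∑ i, d i • conj (z i : ℂ) • szego (β (z i))‖) (F : HardyCoeff) :
    ∃ G : HardyCoeff, ‖G‖ ≤ ‖szegoCompl a F‖ ∧
      ∀ z : unitDisk, ⟪szego (β z), szegoCompl a F⟫_ℂ = z * ⟪szego (β z), G⟫_ℂ := by
  obtain ⟨G, hG, hGY⟩ := exists_inner_eq_of_norm_le
    (Finsupp.linearCombination ℂ (fun z : unitDisk => conj (z : ℂ) • szego (β z)))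
    ((innerSL ℂ (szegoCompl a F)).toLinearMap ∘ₗ
      Finsupp.linearCombination ℂ (fun z => szego (β z))) ‖szegoCompl a F‖ (norm_nonneg _)
    fun c => by
      change ‖⟪szegoCompl a F, Finsupp.linearCombination ℂ (fun z => szego (β z)) c⟫_ℂ‖ ≤ _
      rw [← inner_szegoCompl_right (inner_szego_szegoCompl_self a F)]
      refine (norm_inner_le_norm _ _).trans ?_
      gcongr
      exact norm_linearCombination_le h c
  refine ⟨G, hG, fun z => ?_⟩
  have h1 := congrArg conj (hGY (Finsupp.single z 1))
  simpa [Finsupp.linearCombination_single, inner_smul_left, inner_smul_right, inner_conj_symm]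
    using h1

lemma norm_le_of_exists_quotient {β : unitDisk → unitDisk} {a : unitDisk}
    (h : ∀ F : HardyCoeff, ∃ G : HardyCoeff, ‖G‖ ≤ ‖szegoCompl a F‖ ∧
      ∀ z : unitDisk, ⟪szego (β z), szegoCompl a F⟫_ℂ = z * ⟪szego (β z), G⟫_ℂ)
    {ι : Type*} (s : Finset ι) (z : ι → unitDisk) (d : ι → ℂ) :
    ‖szegoCompl a (∑ i ∈ s, d i • szego (β (z i)))‖ ≤
      ‖∑ i ∈ s, d i • conj (z i : ℂ) • szego (β (z i))‖ := by
  set x := ∑ i ∈ s, d i • szego (β (z i)) with hx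
  obtain ⟨G, hG, hGz⟩ := h x
  have h1 : ⟪x, szegoCompl a x⟫_ℂ = ⟪∑ i ∈ s, d i • conj (z i : ℂ) • szego (β (z i)), G⟫_ℂ := by
    nth_rewrite 1 [hx]
    simp only [sum_inner, inner_smul_left, hGz, Complex.conj_conj]
  have h2 : ⟪szegoCompl a x, szegoCompl a x⟫_ℂ = ⟪szegoCompl a x, x⟫_ℂ :=
    inner_szegoCompl_right (inner_szego_szegoCompl_self a x) x
  have h3 : ‖szegoCompl a x‖ * ‖szegoCompl a x‖ ≤
      ‖∑ i ∈ s, d i • conj (z i : ℂ) • szego (β (z i))‖ * ‖szegoCompl a x‖ := by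
    rw [← inner_self_eq_norm_mul_norm (𝕜 := ℂ), h2]
    refine (RCLike.re_le_norm _).trans ?_
    rw [norm_inner_symm, h1]
    refine (norm_inner_le_norm _ _).trans ?_
    gcongr
  rcases (norm_nonneg (szegoCompl a x)).eq_or_lt with h0 | h0
  · rw [← h0]
    exact norm_nonneg _
  · exact le_of_mul_le_mul_right h3 h0

lemma division_identity_iff (a u : unitDisk) (z : ℂ) (F G : HardyCoeff) :
    (1 - conj (a : ℂ) * u) * ⟪szego u, F⟫_ℂ = z * (1 - conj (a : ℂ) * u) * ⟪szego u, G⟫_ℂ +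
        ⟪szego a, F⟫_ℂ * ((1 - ‖(a : ℂ)‖ ^ 2 : ℝ) : ℂ) ↔
      ⟪szego u, szegoCompl a F⟫_ℂ = z * ⟪szego u, G⟫_ℂ := by
  have h := one_sub_mul_conj_ne_zero u a
  rw [inner_szego_szegoCompl, mul_comm (conj (a : ℂ)), ← mul_right_inj' h, mul_sub,
    sub_eq_iff_eq_add]
  field_simp

lemma norm_le_szegoCompl_iff (a : unitDisk) (F G : HardyCoeff) :
    ‖G‖ ^ 2 + (1 - ‖(a : ℂ)‖ ^ 2) * ‖⟪szego a, F⟫_ℂ‖ ^ 2 ≤ ‖F‖ ^ 2 ↔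
      ‖G‖ ≤ ‖szegoCompl a F‖ := by
  rw [← sq_le_sq₀ (norm_nonneg _) (norm_nonneg _), norm_szegoCompl_sq, le_sub_iff_add_le]

/-- with `a = b 0`, `H(b)` has the complete Nevanlinna–Pick property
iff for every `f ∈ H²` there is `g ∈ H²` with
`(1 - conj a * b z) f(b z) = z (1 - conj a * b z) g(b z) + f(a)(1 - |a|²)` on `𝔻`
and `‖g‖² + (1-|a|²)|f(a)|² ≤ ‖f‖²`. -/
theorem CNP_iff_H2_division (b : ℂ → ℂ) (hb : MemBallHinf b)
    (hnc : NonconstOnDisk b) (a : ℂ) (ha : a = b 0) :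
    HasCNP b ↔
      ∀ (f : ℂ → ℂ) (fa : ℕ → ℂ), MemH2 f fa →
        ∃ (g : ℂ → ℂ) (ga : ℕ → ℂ), MemH2 g ga ∧
          (∀ z ∈ unitDisk,
            (1 - starRingEnd ℂ a * b z) * f (b z)
              = z * (1 - starRingEnd ℂ a * b z) * g (b z)
                + f a * ((1 - ‖a‖ ^ 2 : ℝ) : ℂ)) ∧
          (∑' n, ‖ga n‖ ^ 2) + (1 - ‖a‖ ^ 2) * ‖f a‖ ^ 2 ≤ ∑' n, ‖fa n‖ ^ 2 := by
  subst ha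
  have hmem : ∀ z ∈ unitDisk, b z ∈ unitDisk := fun z hz => hb.apply_mem_unitDisk hnc hz
  have h0 : (0 : ℂ) ∈ unitDisk := Metric.mem_ball_self one_pos
  let β : unitDisk → unitDisk := fun z => ⟨b z, hmem z z.2⟩
  let a : unitDisk := ⟨b 0, hmem 0 h0⟩
  rw [hasCNP_iff_norm_le β (fun _ => rfl) a rfl]
  constructor
  · intro h f fa hf
    obtain ⟨F, hF, hFn⟩ := hf.exists_coeff
    obtain ⟨G, hG, hGz⟩ := exists_quotient_of_norm_le h F
    refine ⟨fun u => ∑' n, G n * u ^ n, G, memH2_of_coeff G, fun z hz => ?_, ?_⟩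
    · have := (division_identity_iff a (β ⟨z, hz⟩) z F G).2 (hGz ⟨z, hz⟩)
      rwa [← hF, ← hF, ← tsum_eq_inner_szego] at this
    · have := (norm_le_szegoCompl_iff a F G).2 hG
      rwa [← hF, hFn, HardyCoeff.norm_sq_eq_tsum] at this
  · intro h n z d
    refine norm_le_of_exists_quotient (fun F => ?_) Finset.univ z d
    obtain ⟨g, ga, hg, hgz, hle⟩ := h _ _ (memH2_of_coeff F)
    obtain ⟨G, hG, hGn⟩ := hg.exists_coeff
    refine ⟨G, (norm_le_szegoCompl_iff a F G).1 ?_, fun w => ?_⟩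
    · rw [hGn, HardyCoeff.norm_sq_eq_tsum F, ← tsum_eq_inner_szego]
      exact hle
    · refine (division_identity_iff a (β w) w F G).1 ?_
      rw [← hG, ← tsum_eq_inner_szego, ← tsum_eq_inner_szego]
      exact hgz w w.2
end
end

section
/- Let b be a nonconstant element of the closed unit ball H∞₁ of the bounded holomorphic functions on the open unit disk 𝔻. If H(b) has the complete Nevanlinna–Pick property, then b is injective on 𝔻. -/
open Complex Set Filter MeasureTheory

noncomputable section

/-- For a `b` with the complete Nevanlinna–Pick property, every value other than `b 0` is
attained at most once in the disk. -/
theorem HasCNP.eq_of_apply_eq {b : ℂ → ℂ} (hb : ∀ z ∈ unitDisk, ‖b z‖ ≤ 1) (hcnp : HasCNP b)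
    {z w : ℂ} (hz : z ∈ unitDisk) (hw : w ∈ unitDisk) (hzw : b z = b w) (hne : b z ≠ b 0) :
    z = w := by
  have h0 : (0 : ℂ) ∈ unitDisk := Metric.mem_ball_self one_pos
  have hlt : ∀ u ∈ unitDisk, normSq (b u) < 1 := by
    intro u hu
    have hle : normSq (b u) ≤ 1 := by
      rw [normSq_eq_norm_sq]
      exact pow_le_one₀ (norm_nonneg _) (hb u hu)
    refine lt_of_le_of_ne hle fun h => hcnp.1 u hu u hu ?_
    have h' : starRingEnd ℂ (b u) * b u = 1 := by
      rw [← normSq_eq_conj_mul_self, h, ofReal_one]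
    simp [dbrKernel, h']
  set D : ℝ := (1 - normSq (b 0)) * (1 - normSq (b z)) with hD
  have hDpos : 0 < D := mul_pos (sub_pos.2 (hlt 0 h0)) (sub_pos.2 (hlt z hz))
  set A : ℝ := (D + normSq (b z - b 0)) / D with hA
  have hA1 : 0 < A - 1 := by
    have h : A - 1 = normSq (b z - b 0) / D := by
      rw [hA]
      field_simp
      ring
    rw [h]
    exact div_pos (normSq_pos.2 (sub_ne_zero.2 hne)) hDpos
  have key : ∀ u ∈ unitDisk, ∀ v ∈ unitDisk, b u = b z → b v = b z →
      1 - dbrKernel b u 0 * dbrKernel b 0 v / (dbrKernel b 0 0 * dbrKernel b u v)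
        = 1 - (A : ℂ) * (1 - starRingEnd ℂ v * u) := by
    intro u hu v hv hbu hbv
    have hk := hcnp.1 u hu v hv
    have hDc : (1 - starRingEnd ℂ (b 0) * b 0) * (1 - starRingEnd ℂ (b z) * b z) ≠ 0 := by
      have h : ((D : ℝ) : ℂ) ≠ 0 := ofReal_ne_zero.2 hDpos.ne'
      rw [hD] at h
      push_cast [normSq_eq_conj_mul_self] at h
      exact h
    simp only [dbrKernel, hbu, hbv] at hk ⊢
    have hden : 1 - starRingEnd ℂ v * u ≠ 0 := fun h => hk (by rw [h, div_zero])
    rw [hA, hD]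
    push_cast [normSq_eq_conj_mul_self]
    simp only [map_sub, map_zero, zero_mul, mul_zero, sub_zero, div_one]
    have h1 := left_ne_zero_of_mul hDc
    have h2 := right_ne_zero_of_mul hDc
    field_simp
    ring
  have hpos := hcnp.2.2 2 ![z, w] (by simp [Fin.forall_fin_two, hz, hw]) ![w, -z]
  simp only [Fin.sum_univ_two, Matrix.cons_val_zero, Matrix.cons_val_one] at hpos
  rw [key z hz z hz rfl rfl, key z hz w hw rfl hzw.symm, key w hw z hz hzw.symm rfl,
    key w hw w hw hzw.symm hzw.symm] at hpos
  have hform : w * starRingEnd ℂ w * (1 - (A : ℂ) * (1 - starRingEnd ℂ z * z))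
        + w * starRingEnd ℂ (-z) * (1 - (A : ℂ) * (1 - starRingEnd ℂ w * z))
        + (-z * starRingEnd ℂ w * (1 - (A : ℂ) * (1 - starRingEnd ℂ z * w))
        + -z * starRingEnd ℂ (-z) * (1 - (A : ℂ) * (1 - starRingEnd ℂ w * w)))
      = ((-((A - 1) * normSq (z - w)) : ℝ) : ℂ) := by
    push_cast [normSq_eq_conj_mul_self]
    simp only [map_sub, map_neg]
    ring
  rw [hform, ofReal_re] at hpos
  have hns : normSq (z - w) = 0 := by
    nlinarith [normSq_nonneg (z - w)]
  exact sub_eq_zero.1 (normSq_eq_zero.1 hns)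

/-- if `H(b)` has the complete Nevanlinna–Pick property then `b` is
injective on the unit disk. -/
theorem CNP_implies_injective (b : ℂ → ℂ) (hb : MemBallHinf b)
    (hnc : NonconstOnDisk b) (hcnp : HasCNP b) :
    Set.InjOn b unitDisk := by
  intro z hz w hw hzw
  by_contra hne
  by_cases hz0 : b z = b 0
  · obtain ⟨U, V, hU, hV, hzU, hwV, hUV⟩ := t2_separation hne
    have hopen : IsOpen unitDisk := Metric.isOpen_ball
    have hmap : ∀ s ⊆ unitDisk, IsOpen s → IsOpen (b '' s) := by
      rcases (hb.1.analyticOnNhd hopen).is_constant_or_isOpen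
        (convex_ball (0 : ℂ) 1).isPreconnected with ⟨c, hc⟩ | h
      · obtain ⟨u, hu, v, hv, huv⟩ := hnc
        exact absurd ((hc u hu).trans (hc v hv).symm) huv
      · exact h
    have hnhds : b '' (U ∩ unitDisk) ∩ b '' (V ∩ unitDisk) ∈ nhds (b z) :=
      ((hmap _ inter_subset_right (hU.inter hopen)).inter
        (hmap _ inter_subset_right (hV.inter hopen))).mem_nhds
        ⟨⟨z, ⟨hzU, hz⟩, rfl⟩, ⟨w, ⟨hwV, hw⟩, hzw.symm⟩⟩
    obtain ⟨c, ⟨⟨u, ⟨huU, hu⟩, rfl⟩, ⟨v, ⟨hvV, hv⟩, hvu⟩⟩, hc⟩ :=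
      Filter.nonempty_of_mem (f := nhdsWithin (b z) {b z}ᶜ)
        (inter_mem (mem_nhdsWithin_of_mem_nhds hnhds) self_mem_nhdsWithin)
    have huv : u = v := hcnp.eq_of_apply_eq hb.2 hu hv hvu.symm (hz0 ▸ hc)
    exact disjoint_left.1 hUV huU (huv ▸ hvV)
  · exact hne (hcnp.eq_of_apply_eq hb.2 hz hw hzw hz0)
end
end

section
/- Let Ω be a simply connected domain in ℂ with 𝔻 ⊆ Ω and Ω ≠ ℂ, let φ : Ω → 𝔻 be a conformal bijection (a holomorphic bijection of Ω onto 𝔻), and let b = φ|_𝔻 be the restriction of φ to the open unit disk 𝔻. Then b ∈ H∞₁ is nonconstant and H(b) has the complete Nevanlinna–Pick property. -/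
open Complex Set Filter MeasureTheory

noncomputable section

open scoped Topology ComplexConjugate

lemma one_sub_conj_mul_ne_zero_s9 {u v : ℂ} (hu : ‖u‖ < 1) (hv : ‖v‖ ≤ 1) :
    1 - conj u * v ≠ 0 := by
  intro h
  have h1 : conj u * v = 1 := (sub_eq_zero.mp h).symm
  have h2 : ‖u‖ * ‖v‖ = 1 := by simpa using congrArg norm h1
  nlinarith [norm_nonneg u, norm_nonneg v]

lemma mem_unitDisk_iff {z : ℂ} : z ∈ unitDisk ↔ ‖z‖ < 1 := by
  simp [unitDisk]

/-- On the unit circle, the reproducing kernel of the Hardy space is the conjugate of a Cauchy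
kernel. -/
lemma div_sub_eq_conj_szego {ζ u : ℂ} (hζ : ‖ζ‖ = 1) :
    ζ / (ζ - u) = conj (1 - conj u * ζ)⁻¹ := by
  have hζ0 : ζ ≠ 0 := by
    rintro rfl
    simp at hζ
  have h : conj ζ = ζ⁻¹ := by
    rw [Complex.inv_def, Complex.normSq_eq_norm_sq, hζ]
    simp
  simp only [map_inv₀, map_sub, map_one, map_mul, Complex.conj_conj, h]
  rw [div_eq_mul_inv]
  have h2 : (1 - u * ζ⁻¹) = ζ⁻¹ * (ζ - u) := by field_simp
  rw [h2, mul_inv, inv_inv]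

/-- Positivity of the de Branges–Rovnyak kernel of a function that is continuous up to the
unit circle. -/
lemma re_sum_dbrKernel_nonneg_of_diffContOnCl {h : ℂ → ℂ}
    (hd : DiffContOnCl ℂ h (Metric.ball 0 1))
    (hb : ∀ z, ‖z‖ ≤ 1 → ‖h z‖ ≤ 1) (n : ℕ) (u c : Fin n → ℂ) (hu : ∀ i, ‖u i‖ < 1) :
    0 ≤ (∑ i, ∑ j, c i * conj (c j) * dbrKernel h (u i) (u j)).re := by
  set k : Fin n → ℂ → ℂ := fun j ζ => (1 - conj (u j) * ζ)⁻¹ with hk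
  set F : ℂ → ℂ := fun ζ => ∑ j, conj (c j) * k j ζ with hF
  set G : ℂ → ℂ := fun ζ => ∑ j, conj (c j) * conj (h (u j)) * k j ζ with hG
  set q : Fin n → ℂ → ℂ := fun i ζ => c i * (F ζ + h (u i) * G ζ - 2 * (h ζ * G ζ)) with hq
  have hcl : closure (Metric.ball (0 : ℂ) 1) = Metric.closedBall 0 1 :=
    closure_ball _ one_ne_zero
  have hkd : ∀ j, DifferentiableOn ℂ (k j) (Metric.closedBall 0 1) := by
    intro j ζ hζ
    have := one_sub_conj_mul_ne_zero_s9 (hu j) (mem_closedBall_zero_iff.mp hζ)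
    apply DifferentiableAt.differentiableWithinAt
    simp only [hk]
    fun_prop (disch := exact this)
  have hFd : DifferentiableOn ℂ F (Metric.closedBall 0 1) :=
    DifferentiableOn.fun_sum fun j _ => (hkd j).const_mul _
  have hGd : DifferentiableOn ℂ G (Metric.closedBall 0 1) :=
    DifferentiableOn.fun_sum fun j _ => (hkd j).const_mul _
  have hFc : DiffContOnCl ℂ F (Metric.ball 0 1) := (hcl ▸ hFd).diffContOnCl
  have hGc : DiffContOnCl ℂ G (Metric.ball 0 1) := (hcl ▸ hGd).diffContOnCl
  have hqd : ∀ i, DiffContOnCl ℂ (q i) (Metric.ball 0 1) := by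
    intro i
    exact ((hFc.add (hGc.const_smul (h (u i)))).sub ((hd.smul hGc).const_smul (2 : ℂ))).const_smul
      (c i)
  set P : ℂ → ℂ := fun ζ => ∑ i, (ζ / (ζ - u i)) * q i ζ with hP
  have hint : ∀ i, CircleIntegrable (fun ζ => (ζ / (ζ - u i)) * q i ζ) 0 1 := by
    intro i
    apply ContinuousOn.circleIntegrable zero_le_one
    have hc : ContinuousOn (q i) (Metric.sphere 0 1) :=
      (hqd i).continuousOn.mono (hcl ▸ Metric.sphere_subset_closedBall)
    refine ContinuousOn.mul (ContinuousOn.div continuousOn_id (by fun_prop) ?_) hc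
    intro ζ hζ h0
    have h1 : ζ = u i := sub_eq_zero.mp h0
    have h2 := hu i
    rw [← h1, mem_sphere_zero_iff_norm.mp hζ] at h2
    exact lt_irrefl _ h2
  have havg : Real.circleAverage P 0 1 = ∑ i, q i (u i) := by
    rw [hP, Real.circleAverage_fun_sum fun i _ => hint i]
    refine Finset.sum_congr rfl fun i _ => ?_
    have := DiffContOnCl.circleAverage_smul_div (c := 0) (R := 1) (w := u i) (f := q i)
      (by simpa using hqd i) (by simpa using hu i)
    simpa using this
  have hsum : ∑ i, ∑ j, c i * conj (c j) * dbrKernel h (u i) (u j) = ∑ i, q i (u i) := by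
    refine Finset.sum_congr rfl fun i _ => ?_
    have : q i (u i) = c i * (F (u i) - h (u i) * G (u i)) := by
      simp only [hq]
      ring
    rw [this, hF, hG]
    simp only [Finset.mul_sum, ← Finset.sum_sub_distrib]
    refine Finset.sum_congr rfl fun j _ => ?_
    simp only [dbrKernel, hk, div_eq_mul_inv]
    ring
  have hPre : ∀ ζ ∈ Metric.sphere (0 : ℂ) |1|, 0 ≤ (Complex.reCLM ∘ P) ζ := by
    intro ζ hζ
    have hζ1 : ‖ζ‖ = 1 := by simpa using hζ
    have hPζ : P ζ = F ζ * conj (F ζ) + G ζ * conj (G ζ) - 2 * (h ζ * G ζ * conj (F ζ)) := by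
      have e1 : conj (F ζ) = ∑ i, c i * conj (k i ζ) := by simp [hF]
      have e2 : conj (G ζ) = ∑ i, c i * h (u i) * conj (k i ζ) := by simp [hG]
      rw [e1, e2]
      simp only [hP, Finset.mul_sum, ← Finset.sum_sub_distrib, ← Finset.sum_add_distrib]
      refine Finset.sum_congr rfl fun i _ => ?_
      rw [div_sub_eq_conj_szego hζ1]
      simp only [hq, hk]
      ring
    have h1 : (h ζ * G ζ * conj (F ζ)).re ≤ ‖G ζ‖ * ‖F ζ‖ := by
      refine (Complex.re_le_norm _).trans ?_
      rw [norm_mul, norm_mul, Complex.norm_conj]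
      gcongr
      exact mul_le_of_le_one_left (norm_nonneg _) (hb ζ hζ1.le)
    have h2 : (P ζ).re = ‖F ζ‖ ^ 2 + ‖G ζ‖ ^ 2 - 2 * (h ζ * G ζ * conj (F ζ)).re := by
      rw [hPζ, Complex.mul_conj', Complex.mul_conj', Complex.sub_re, Complex.add_re,
        ← Complex.ofReal_pow, ← Complex.ofReal_pow, Complex.ofReal_re, Complex.ofReal_re]
      simp
    simp only [Function.comp_apply, Complex.reCLM_apply, h2]
    nlinarith [sq_nonneg (‖F ζ‖ - ‖G ζ‖)]
  have hPint : CircleIntegrable P 0 1 := CircleIntegrable.fun_sum _ fun i _ => hint i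
  have := Real.circleAverage_nonneg_of_nonneg hPre
  rwa [ContinuousLinearMap.circleAverage_comp_comm _ hPint, havg, ← hsum] at this

/-- The de Branges–Rovnyak kernel of a function in the closed unit ball of `H∞` is positive. -/
lemma MemBallHinf.re_sum_dbrKernel_nonneg {h : ℂ → ℂ} (hh : MemBallHinf h) (n : ℕ)
    (u c : Fin n → ℂ) (hu : ∀ i, ‖u i‖ < 1) :
    0 ≤ (∑ i, ∑ j, c i * conj (c j) * dbrKernel h (u i) (u j)).re := by
  obtain ⟨hd, hb⟩ := hh
  have hcont : ∀ i, Tendsto (fun r : ℝ => h (r * u i)) (𝓝[<] 1) (𝓝 (h (u i))) := by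
    intro i
    have h1 : ContinuousAt h (u i) :=
      (hd.differentiableAt (Metric.isOpen_ball.mem_nhds (mem_unitDisk_iff.mpr (hu i)))).continuousAt
    refine h1.tendsto.comp (Tendsto.mono_left ?_ nhdsWithin_le_nhds)
    have : Continuous fun r : ℝ => (r : ℂ) * u i := by fun_prop
    simpa using this.tendsto 1
  have hlim : Tendsto (fun r : ℝ => (∑ i, ∑ j, c i * conj (c j) *
      dbrKernel (fun z => h (r * z)) (u i) (u j)).re) (𝓝[<] 1)
      (𝓝 (∑ i, ∑ j, c i * conj (c j) * dbrKernel h (u i) (u j)).re) := by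
    refine (Complex.continuous_re.tendsto _).comp ?_
    refine tendsto_finsetSum _ fun i _ => tendsto_finsetSum _ fun j _ => ?_
    refine Tendsto.const_mul _ ?_
    refine Tendsto.div_const (Tendsto.const_sub _ (Tendsto.mul ?_ (hcont i))) _
    exact (Complex.continuous_conj.tendsto _).comp (hcont j)
  refine ge_of_tendsto hlim ?_
  filter_upwards [Ioo_mem_nhdsLT (zero_lt_one' ℝ)] with r hr
  have hmem : ∀ z : ℂ, ‖z‖ ≤ 1 → (r : ℂ) * z ∈ unitDisk := by
    intro z hz
    rw [mem_unitDisk_iff, norm_mul, Complex.norm_real, Real.norm_of_nonneg hr.1.le]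
    nlinarith [hr.1, hr.2, norm_nonneg z]
  refine re_sum_dbrKernel_nonneg_of_diffContOnCl ?_ (fun z hz => hb _ (hmem z hz)) n u c hu
  apply DifferentiableOn.diffContOnCl
  rw [closure_ball _ one_ne_zero]
  exact hd.comp (by fun_prop) fun z hz => hmem z (mem_closedBall_zero_iff.mp hz)

/-- The inverse of an injective holomorphic function is holomorphic. -/
lemma differentiableAt_of_leftInvOn {f g : ℂ → ℂ} {U : Set ℂ} (hU : IsOpen U)
    (hf : DifferentiableOn ℂ f U) (hinj : InjOn f U) (hg : LeftInvOn g f U) {z : ℂ} (hz : z ∈ U) :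
    DifferentiableAt ℂ g (f z) := by
  have han : AnalyticOnNhd ℂ f U := hf.analyticOnNhd hU
  have hnc : ∀ w ∈ U, ¬ ∀ᶠ x in 𝓝 w, f x = f w := by
    intro w hw hev
    have h1 : ∀ᶠ x in 𝓝 w, x = w := by
      filter_upwards [hev, hU.mem_nhds hw] with x hx hxU using hinj hxU hw hx
    have h2 : ∀ᶠ x in 𝓝[≠] w, x = w := h1.filter_mono nhdsWithin_le_nhds
    obtain ⟨x, hx, hx'⟩ := (h2.and self_mem_nhdsWithin).exists
    exact hx' hx
  have hmap : ∀ w ∈ U, 𝓝 (f w) ≤ map f (𝓝 w) := fun w hw =>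
    (han w hw).eventually_constant_or_nhds_le_map_nhds.resolve_left (hnc w hw)
  have himg : ∀ w ∈ U, ∀ᶠ y in 𝓝 (f w), g y ∈ U ∧ f (g y) = y := by
    intro w hw
    refine hmap w hw (mem_map.mpr ?_)
    filter_upwards [hU.mem_nhds hw] with x hx
    exact ⟨by rwa [hg hx], by rw [hg hx]⟩
  have hcont : ∀ w ∈ U, ContinuousAt g (f w) := by
    intro w hw
    rw [ContinuousAt, hg hw]
    refine (tendsto_map' ?_ : Tendsto g (map f (𝓝 w)) (𝓝 w)).mono_left (hmap w hw)
    refine tendsto_id.congr' ?_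
    filter_upwards [hU.mem_nhds hw] with x hx using (hg hx).symm
  have hdiff : ∀ w ∈ U, deriv f w ≠ 0 → DifferentiableAt ℂ g (f w) := by
    intro w hw hw'
    have h1 : HasDerivAt f (deriv f w) (g (f w)) := by
      rw [hg hw]
      exact (han w hw).differentiableAt.hasDerivAt
    exact (HasDerivAt.of_local_left_inverse (hcont w hw) h1 hw'
      ((himg w hw).mono fun y hy => hy.2)).differentiableAt
  have hev : ∀ᶠ x in 𝓝[≠] z, deriv f x ≠ 0 := by
    refine (han z hz).deriv.eventually_eq_zero_or_eventually_ne_zero.resolve_left fun h0 => ?_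
    obtain ⟨ε, hε, hball⟩ := Metric.eventually_nhds_iff_ball.mp (h0.and (hU.mem_nhds hz))
    refine hnc z hz ?_
    filter_upwards [Metric.ball_mem_nhds z hε] with x hx
    refine (convex_ball z ε).is_const_of_fderivWithin_eq_zero (𝕜 := ℂ)
      (hf.mono fun y hy => (hball y hy).2) (fun y hy => ?_) hx (Metric.mem_ball_self hε)
    rw [fderivWithin_of_isOpen Metric.isOpen_ball hy]
    ext
    simpa using (hball y hy).1
  refine (analyticAt_of_differentiable_on_punctured_nhds_of_continuousAt ?_
    (hcont z hz)).differentiableAt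
  have htend : Tendsto g (𝓝[≠] (f z)) (𝓝[≠] z) := by
    refine tendsto_nhdsWithin_iff.mpr ⟨?_, ?_⟩
    · have := (hcont z hz).tendsto.mono_left (nhdsWithin_le_nhds (s := {f z}ᶜ))
      rwa [hg hz] at this
    · filter_upwards [self_mem_nhdsWithin, (himg z hz).filter_mono nhdsWithin_le_nhds] with y hy hy'
      intro h0
      exact hy (by rw [mem_singleton_iff, ← hy'.2, h0])
  filter_upwards [htend.eventually hev, (himg z hz).filter_mono nhdsWithin_le_nhds] with y hy hy'
  have := hdiff (g y) hy'.1 hy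
  rwa [hy'.2] at this

/-- A conformal bijection `f` of a set containing the disk onto the disk, with `f 0 = 0`,
satisfies `f z = z * h (f z)` on the disk for some `h` in the unit ball of `H∞`. -/
lemma exists_memBallHinf_eq_mul_comp {Ω : Set ℂ} (hΩ : IsOpen Ω) (hsub : unitDisk ⊆ Ω)
    {f : ℂ → ℂ} (hf : DifferentiableOn ℂ f Ω) (hbij : BijOn f Ω unitDisk) (h0 : f 0 = 0) :
    ∃ h : ℂ → ℂ, MemBallHinf h ∧ ∀ z ∈ unitDisk, f z = z * h (f z) := by
  have h0D : (0 : ℂ) ∈ unitDisk := by simp [unitDisk]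
  set g := Function.invFunOn f Ω
  have hgl : LeftInvOn g f Ω := hbij.injOn.leftInvOn_invFunOn
  have hgr : ∀ u ∈ unitDisk, g u ∈ Ω ∧ f (g u) = u := fun u hu =>
    ⟨Function.invFunOn_mem (hbij.surjOn hu), Function.invFunOn_eq (hbij.surjOn hu)⟩
  have hg0 : g 0 = 0 := by
    have := hgl (hsub h0D)
    rwa [h0] at this
  have hgd : ∀ u ∈ unitDisk, DifferentiableAt ℂ g u := by
    intro u hu
    have := differentiableAt_of_leftInvOn hΩ hf hbij.injOn hgl (hgr u hu).1
    rwa [(hgr u hu).2] at this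
  have hfD : DifferentiableOn ℂ f (Metric.ball 0 1) := hf.mono hsub
  have hmaps : MapsTo f (Metric.ball 0 1) (Metric.closedBall 0 1) := fun z hz =>
    Metric.ball_subset_closedBall (hbij.mapsTo (hsub hz))
  have hderiv : deriv f 0 * deriv g 0 = 1 := by
    have hfa : DifferentiableAt ℂ f (g 0) := by
      rw [hg0]
      exact hf.differentiableAt (hΩ.mem_nhds (hsub h0D))
    have h1 : HasDerivAt (f ∘ g) (deriv f (g 0) * deriv g 0) 0 :=
      hfa.hasDerivAt.comp 0 (hgd 0 h0D).hasDerivAt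
    have h2 : HasDerivAt (f ∘ g) 1 0 := by
      refine (hasDerivAt_id (0 : ℂ)).congr_of_eventuallyEq ?_
      filter_upwards [Metric.isOpen_ball.mem_nhds h0D] with u hu using (hgr u hu).2
    simpa [hg0] using h1.unique h2
  have hgeq : ∀ u, g u = u * dslope g 0 u := by
    intro u
    have := sub_smul_dslope g 0 u
    simpa [hg0] using this.symm
  have hge : ∀ u ∈ unitDisk, 1 ≤ ‖dslope g 0 u‖ := by
    intro u hu
    rcases eq_or_ne u 0 with rfl | hu0
    · rw [dslope_same]
      have h1 : ‖deriv f 0‖ ≤ 1 :=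
        norm_deriv_le_one_of_mapsTo_ball hfD (by rwa [h0]) one_pos
      have h2 : ‖deriv f 0‖ * ‖deriv g 0‖ = 1 := by rw [← norm_mul, hderiv, norm_one]
      nlinarith [norm_nonneg (deriv g 0)]
    · have h1 : ‖u‖ ≤ ‖g u‖ := by
        rcases lt_or_ge ‖g u‖ 1 with h | h
        · have := norm_le_norm_of_mapsTo_ball hfD hmaps h0 h
          rwa [(hgr u hu).2] at this
        · exact (mem_unitDisk_iff.mp hu).le.trans h
      rw [hgeq u, norm_mul] at h1
      exact (le_mul_iff_one_le_right (norm_pos_iff.mpr hu0)).mp h1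
  have hne : ∀ u ∈ unitDisk, dslope g 0 u ≠ 0 := fun u hu =>
    norm_pos_iff.mp (zero_lt_one.trans_le (hge u hu))
  refine ⟨fun u => (dslope g 0 u)⁻¹, ⟨DifferentiableOn.inv ?_ hne, fun u hu => ?_⟩, fun z hz => ?_⟩
  · refine (differentiableOn_dslope (Metric.isOpen_ball.mem_nhds h0D)).mpr ?_
    exact fun u hu => (hgd u hu).differentiableWithinAt
  · rw [norm_inv]
    exact inv_le_one_of_one_le₀ (hge u hu)
  · have hfz := hbij.mapsTo (hsub hz)
    have h1 := hgeq (f z)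
    rw [hgl (hsub hz)] at h1
    rw [eq_mul_inv_iff_mul_eq₀ (hne _ hfz)]
    exact h1.symm

/-- The disk automorphism sending `a` to `0`. -/
def diskAut (a u : ℂ) : ℂ := (u - a) / (1 - conj a * u)

lemma one_sub_conj_diskAut_mul {a u v : ℂ} (ha : ‖a‖ < 1) (hu : ‖u‖ < 1) (hv : ‖v‖ < 1) :
    1 - conj (diskAut a v) * diskAut a u =
      (1 - conj a * a) * (1 - conj v * u) / ((1 - conj a * u) * (1 - conj v * a)) := by
  have h1 := one_sub_conj_mul_ne_zero_s9 ha hu.le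
  have h2 := one_sub_conj_mul_ne_zero_s9 hv ha.le
  have h3 : 1 - a * conj v ≠ 0 := by rwa [mul_comm]
  simp only [diskAut, map_div₀, map_sub, map_one, map_mul, Complex.conj_conj]
  field_simp
  ring

lemma norm_diskAut_lt_one {a u : ℂ} (ha : ‖a‖ < 1) (hu : ‖u‖ < 1) : ‖diskAut a u‖ < 1 := by
  have h := one_sub_conj_diskAut_mul ha hu hu
  have h1 := one_sub_conj_mul_ne_zero_s9 ha hu.le
  have e : (1 - conj a * u) * (1 - conj u * a) = ((‖1 - conj a * u‖ ^ 2 : ℝ) : ℂ) := by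
    rw [Complex.ofReal_pow, ← Complex.mul_conj']
    simp [mul_comm]
  rw [e, Complex.conj_mul', Complex.conj_mul', Complex.conj_mul'] at h
  have h' : 1 - ‖diskAut a u‖ ^ 2 = (1 - ‖a‖ ^ 2) * (1 - ‖u‖ ^ 2) / ‖1 - conj a * u‖ ^ 2 := by
    exact_mod_cast h
  have hpos : 0 < (1 - ‖a‖ ^ 2) * (1 - ‖u‖ ^ 2) / ‖1 - conj a * u‖ ^ 2 := by
    have := norm_pos_iff.mpr h1
    have := norm_nonneg a
    have := norm_nonneg u
    have : 0 < 1 - ‖a‖ ^ 2 := by nlinarith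
    have : 0 < 1 - ‖u‖ ^ 2 := by nlinarith
    positivity
  nlinarith [norm_nonneg (diskAut a u)]

lemma diskAut_neg_diskAut {a u : ℂ} (ha : ‖a‖ < 1) (hu : ‖u‖ < 1) :
    diskAut (-a) (diskAut a u) = u := by
  have h1 := one_sub_conj_mul_ne_zero_s9 ha hu.le
  have h2 := one_sub_conj_mul_ne_zero_s9 ha ha.le
  have e : 1 + conj a * diskAut a u = (1 - conj a * a) / (1 - conj a * u) := by
    rw [diskAut]
    field_simp
    ring
  rw [diskAut]
  have e' : diskAut a u + a = u * (1 - conj a * a) / (1 - conj a * u) := by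
    rw [diskAut, div_add' _ _ _ h1]
    congr 1
    ring
  simp only [map_neg, neg_mul, sub_neg_eq_add, e, e']
  rw [div_div_div_cancel_right₀ h1, mul_div_cancel_right₀ _ h2]

lemma bijOn_diskAut {a : ℂ} (ha : ‖a‖ < 1) : BijOn (diskAut a) unitDisk unitDisk := by
  have ha' : ‖-a‖ < 1 := by simpa using ha
  refine InvOn.bijOn (f' := diskAut (-a)) ⟨fun u hu => ?_, fun u hu => ?_⟩ (fun u hu => ?_)
    fun u hu => ?_
  all_goals rw [mem_unitDisk_iff] at hu
  · exact diskAut_neg_diskAut ha hu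
  · simpa using diskAut_neg_diskAut ha' hu
  · exact mem_unitDisk_iff.mpr (norm_diskAut_lt_one ha hu)
  · exact mem_unitDisk_iff.mpr (norm_diskAut_lt_one ha' hu)

lemma differentiableOn_diskAut {a : ℂ} (ha : ‖a‖ < 1) :
    DifferentiableOn ℂ (diskAut a) unitDisk := by
  intro u hu
  have := one_sub_conj_mul_ne_zero_s9 ha (mem_unitDisk_iff.mp hu).le
  apply DifferentiableAt.differentiableWithinAt
  unfold diskAut
  fun_prop (disch := exact this)

lemma conj_dbrKernel (b : ℂ → ℂ) (z w : ℂ) : conj (dbrKernel b w z) = dbrKernel b z w := by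
  simp [dbrKernel, mul_comm]

/-- With `f z = diskAut (b 0) (b z) = z * h (f z)`, the complete Pick kernel of `b` is
a rank-one multiple of the de Branges–Rovnyak kernel of `h`. -/
lemma one_sub_normalized_dbrKernel_eq {b h : ℂ → ℂ} (hb : ∀ z ∈ unitDisk, ‖b z‖ < 1)
    (hbh : ∀ z ∈ unitDisk, diskAut (b 0) (b z) = z * h (diskAut (b 0) (b z)))
    {z w : ℂ} (hz : z ∈ unitDisk) (hw : w ∈ unitDisk) :
    1 - dbrKernel b z 0 * dbrKernel b 0 w / (dbrKernel b 0 0 * dbrKernel b z w) =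
      z * conj w * dbrKernel h (diskAut (b 0) (b z)) (diskAut (b 0) (b w)) := by
  have h0D : (0 : ℂ) ∈ unitDisk := by simp [unitDisk]
  have ha := hb 0 h0D
  have key := one_sub_conj_diskAut_mul ha (hb z hz) (hb w hw)
  have hez := hbh z hz
  have hew := hbh w hw
  have hu := norm_diskAut_lt_one ha (hb z hz)
  have hv := norm_diskAut_lt_one ha (hb w hw)
  set u := diskAut (b 0) (b z)
  set v := diskAut (b 0) (b w)
  have n1 := one_sub_conj_mul_ne_zero_s9 hv hu.le
  have n2 := one_sub_conj_mul_ne_zero_s9 ha ha.le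
  have n3 := one_sub_conj_mul_ne_zero_s9 ha (hb z hz).le
  have n4 := one_sub_conj_mul_ne_zero_s9 (hb w hw) ha.le
  have n5 := one_sub_conj_mul_ne_zero_s9 (hb w hw) (hb z hz).le
  have n6 := one_sub_conj_mul_ne_zero_s9 (mem_unitDisk_iff.mp hw) (mem_unitDisk_iff.mp hz).le
  have e1 : dbrKernel b z 0 * dbrKernel b 0 w / (dbrKernel b 0 0 * dbrKernel b z w) =
      (1 - conj w * z) / (1 - conj v * u) := by
    rw [key]
    simp only [dbrKernel, map_zero, zero_mul, mul_zero, sub_zero, div_one]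
    generalize 1 - conj w * z = A at *
    generalize 1 - conj (b w) * b z = B at *
    generalize 1 - conj (b 0) * b 0 = C at *
    generalize 1 - conj (b 0) * b z = D at *
    generalize 1 - conj (b w) * b 0 = E at *
    field_simp
  have e2 : conj w * z * (1 - conj (h v) * h u) = conj w * z - conj v * u := by
    have : conj v = conj w * conj (h v) := by rw [← map_mul, ← hew]
    rw [this]
    conv_rhs => rw [hez]
    ring
  rw [e1, dbrKernel, ← mul_div_assoc, mul_comm z, e2, eq_div_iff n1, sub_mul, div_mul_cancel₀ _ n1]
  ring

/-- if `Ω` is a simply connected domain with `𝔻 ⊆ Ω ≠ ℂ` and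
`φ : Ω → 𝔻` is a conformal bijection, then the restriction `b = φ|_𝔻` is a
nonconstant element of `H∞₁` and `H(b)` has the complete Nevanlinna–Pick
property. -/
theorem riemannMap_restriction_CNP (Ω : Set ℂ) (hΩopen : IsOpen Ω)
    (hΩconn : IsConnected Ω) (hΩsc : SimplyConnectedSpace Ω)
    (hsub : unitDisk ⊆ Ω) (hne : Ω ≠ Set.univ)
    (φ : ℂ → ℂ) (hφ : DifferentiableOn ℂ φ Ω) (hbij : Set.BijOn φ Ω unitDisk) :
    MemBallHinf φ ∧ NonconstOnDisk φ ∧ HasCNP φ := by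
  have h0D : (0 : ℂ) ∈ unitDisk := by simp [unitDisk]
  have hlt : ∀ z ∈ unitDisk, ‖φ z‖ < 1 := fun z hz =>
    mem_unitDisk_iff.mp (hbij.mapsTo (hsub hz))
  have ha := hlt 0 h0D
  refine ⟨⟨hφ.mono hsub, fun z hz => (hlt z hz).le⟩, ⟨0, h0D, 1 / 2, ?_, ?_⟩, ?_, ?_, ?_⟩
  · rw [mem_unitDisk_iff]
    norm_num
  · intro h
    have h2 : (1 / 2 : ℂ) ∈ unitDisk := by
      rw [mem_unitDisk_iff]
      norm_num
    simpa using hbij.injOn (hsub h0D) (hsub h2) h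
  · intro z hz w hw
    exact div_ne_zero (one_sub_conj_mul_ne_zero_s9 (hlt w hw) (hlt z hz).le)
      (one_sub_conj_mul_ne_zero_s9 (mem_unitDisk_iff.mp hw) (mem_unitDisk_iff.mp hz).le)
  · intro z _ w _
    simp only [map_sub, map_one, map_div₀, map_mul, conj_dbrKernel]
    rw [mul_comm (dbrKernel φ 0 w)]
  · intro n lam hlam c
    obtain ⟨h, hh, hφh⟩ := exists_memBallHinf_eq_mul_comp hΩopen hsub
      ((differentiableOn_diskAut ha).comp hφ hbij.mapsTo) ((bijOn_diskAut ha).comp hbij)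
      (by simp [diskAut])
    have := hh.re_sum_dbrKernel_nonneg n (fun i => diskAut (φ 0) (φ (lam i)))
      (fun i => c i * lam i) fun i => norm_diskAut_lt_one ha (hlt _ (hlam i))
    convert this using 4 with i _ j _
    simp only [one_sub_normalized_dbrKernel_eq hlt hφh (hlam i) (hlam j), map_mul]
    ring
end
end

section
/- Let A, B ∈ ℂ with B ≠ 0 and |A| + 1 ≤ |B|, and let b(z) = (z + A)/B for z in the open unit disk 𝔻. Then b is a nonconstant element of H∞₁ and H(b) has the complete Nevanlinna–Pick property. -/
open Complex Set Filter MeasureTheory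

noncomputable section

namespace IsPosKernel

theorem congr_s11 {K L : ℂ → ℂ → ℂ} (hL : IsPosKernel L)
    (h : ∀ z ∈ unitDisk, ∀ w ∈ unitDisk, K z w = L z w) : IsPosKernel K := by
  refine ⟨fun z hz w hw => ?_, fun n lam hlam c => ?_⟩
  · rw [h z hz w hw, h w hw z hz, hL.1 z hz w hw]
  · simpa only [h _ (hlam _) _ (hlam _)] using hL.2 n lam hlam c

theorem add {K L : ℂ → ℂ → ℂ} (hK : IsPosKernel K) (hL : IsPosKernel L) :
    IsPosKernel fun z w => K z w + L z w := by
  refine ⟨fun z hz w hw => ?_, fun n lam hlam c => ?_⟩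
  · rw [map_add, ← hK.1 z hz w hw, ← hL.1 z hz w hw]
  · simpa only [mul_add, Finset.sum_add_distrib, add_re] using
      add_nonneg (hK.2 n lam hlam c) (hL.2 n lam hlam c)

theorem const_mul {K : ℂ → ℂ → ℂ} (hK : IsPosKernel K) {r : ℝ} (hr : 0 ≤ r) :
    IsPosKernel fun z w => r * K z w := by
  refine ⟨fun z hz w hw => ?_, fun n lam hlam c => ?_⟩
  · rw [map_mul, conj_ofReal, ← hK.1 z hz w hw]
  · simpa only [mul_left_comm _ (r : ℂ), ← Finset.mul_sum, re_ofReal_mul] using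
      mul_nonneg hr (hK.2 n lam hlam c)

end IsPosKernel

theorem sum_sum_mul_conj_re_nonneg {ι : Type*} [Fintype ι] (c f : ι → ℂ) :
    0 ≤ (∑ i, ∑ j, c i * starRingEnd ℂ (c j) * (f i * starRingEnd ℂ (f j))).re := by
  have h : ∑ i, ∑ j, c i * starRingEnd ℂ (c j) * (f i * starRingEnd ℂ (f j)) =
      (∑ i, c i * f i) * starRingEnd ℂ (∑ i, c i * f i) := by
    rw [map_sum, Finset.sum_mul_sum]
    refine Finset.sum_congr rfl fun i _ => Finset.sum_congr rfl fun j _ => ?_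
    rw [map_mul]
    ring
  rw [h, mul_conj, ofReal_re]
  exact normSq_nonneg _

theorem isPosKernel_mul_conj (f : ℂ → ℂ) :
    IsPosKernel fun z w => f z * starRingEnd ℂ (f w) :=
  ⟨fun z _ w _ => by simp [mul_comm], fun _ lam _ c =>
    sum_sum_mul_conj_re_nonneg c fun i => f (lam i)⟩

/-- The pullback of the Szegő kernel along a self-map of the disk, rescaled by `f`, is positive. -/
theorem isPosKernel_szego (f φ : ℂ → ℂ) (hφ : ∀ z ∈ unitDisk, ‖φ z‖ < 1) :
    IsPosKernel fun z w =>
      f z * starRingEnd ℂ (f w) / (1 - φ z * starRingEnd ℂ (φ w)) := by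
  refine ⟨fun z _ w _ => by simp [mul_comm], fun n lam hlam c => ?_⟩
  have key : HasSum (fun k : ℕ => ∑ i, ∑ j, c i * starRingEnd ℂ (c j) *
      ((f (lam i) * φ (lam i) ^ k) * starRingEnd ℂ (f (lam j) * φ (lam j) ^ k)))
      (∑ i, ∑ j, c i * starRingEnd ℂ (c j) *
        (f (lam i) * starRingEnd ℂ (f (lam j)) /
          (1 - φ (lam i) * starRingEnd ℂ (φ (lam j))))) := by
    refine hasSum_sum fun i _ => hasSum_sum fun j _ => HasSum.mul_left _ ?_
    have hlt : ‖φ (lam i) * starRingEnd ℂ (φ (lam j))‖ < 1 := by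
      rw [norm_mul, RCLike.norm_conj]
      exact mul_lt_one_of_nonneg_of_lt_one_left (norm_nonneg _) (hφ _ (hlam i))
        (hφ _ (hlam j)).le
    rw [div_eq_mul_inv]
    convert (hasSum_geometric_of_norm_lt_one hlt).mul_left
      (f (lam i) * starRingEnd ℂ (f (lam j))) using 2 with k
    rw [map_mul, map_pow, mul_pow]
    ring
  exact (hasSum_re key).nonneg fun k =>
    sum_sum_mul_conj_re_nonneg c fun i => f (lam i) * φ (lam i) ^ k

theorem exists_norm_eq_one_conj_eq (A : ℂ) :
    ∃ ω : ℂ, ω * starRingEnd ℂ ω = 1 ∧ A = ‖A‖ * starRingEnd ℂ ω := by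
  refine ⟨exp (-(arg A * I)), ?_, ?_⟩
  · rw [← exp_conj, ← exp_add]
    simp
  · rw [← exp_conj]
    simp

/-- The complete Pick defect of the affine symbol, with `z', A', B'` standing for conjugates. -/
theorem affine_pick_defect {z z' A A' B B' R : ℂ} (hB : B ≠ 0) (hB' : B' ≠ 0)
    (hR : R = B * B' - A * A') (hR0 : R ≠ 0)
    (hN : B * B' - (z + A) * (z' + A') ≠ 0) :
    1 - (1 - A' / B' * ((z + A) / B)) * (1 - (z' + A') / B' * (A / B)) /
      ((1 - A' / B' * (A / B)) * ((1 - (z' + A') / B' * ((z + A) / B)) / (1 - z' * z))) =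
    z * z' * ((R - A' * z) * (R - A * z') - B * B') /
      ((R - A' * z) * (R - A * z') - B * B' * (z * z')) := by
  have h1 : 1 - A' / B' * ((z + A) / B) = (R - A' * z) / (B * B') := by
    rw [hR]; field_simp; ring
  have h2 : 1 - (z' + A') / B' * (A / B) = (R - A * z') / (B * B') := by
    rw [hR]; field_simp; ring
  have h3 : 1 - A' / B' * (A / B) = R / (B * B') := by
    rw [hR]; field_simp
  have h4 : 1 - (z' + A') / B' * ((z + A) / B) =
      (B * B' - (z + A) * (z' + A')) / (B * B') := by
    field_simp
  have h5 : (R - A' * z) * (R - A * z') - B * B' * (z * z') =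
      R * (B * B' - (z + A) * (z' + A')) := by
    rw [hR]; ring
  rw [h1, h2, h3, h4, h5]
  field_simp
  rw [hR]
  ring

/-- Decomposition of the Pick defect into visibly positive kernels. -/
theorem affine_pick_decomposition {z z' ω ω' α β R u u' : ℂ} (hR : R = β ^ 2 - α ^ 2)
    (hR0 : R ≠ 0) (hω : ω * ω' = 1) (hu : u = R - α * ω * z) (hu' : u' = R - α * ω' * z')
    (hu0 : u ≠ 0) (hu0' : u' ≠ 0) (hM : u * u' - β ^ 2 * (z * z') ≠ 0) :
    z * z' * (u * u' - β ^ 2) / (u * u' - β ^ 2 * (z * z')) =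
      (1 - ((β + α) / R) ^ 2) * (z * z' / (1 - β * z / u * (β * z' / u'))) +
      (β + α) * α / R ^ 2 * (z * z') +
      β * α / R ^ 2 * (z * (1 - ω * (β * z / u)) * (z' * (1 - ω' * (β * z' / u'))) /
        (1 - β * z / u * (β * z' / u'))) := by
  have h1 : 1 - β * z / u * (β * z' / u') = (u * u' - β ^ 2 * (z * z')) / (u * u') := by
    field_simp
  obtain ⟨M, hMdef⟩ : ∃ M, M = u * u' - β ^ 2 * (z * z') := ⟨_, rfl⟩
  rw [← hMdef] at h1 hM ⊢
  have h2 : 1 - ω * (β * z / u) = (u - ω * β * z) / u := by field_simp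
  have h3 : 1 - ω' * (β * z' / u') = (u' - ω' * β * z') / u' := by field_simp
  rw [h1, h2, h3]
  field_simp
  obtain rfl : ω' = ω⁻¹ := eq_inv_of_mul_eq_one_right hω
  have hω0 : ω ≠ 0 := left_ne_zero_of_mul_eq_one hω
  rw [hMdef, hu, hu', hR]
  field_simp
  ring

theorem norm_lt_one_of_mem_unitDisk_s11 {z : ℂ} (hz : z ∈ unitDisk) : ‖z‖ < 1 := by
  simpa [unitDisk] using hz

/-- for `B ≠ 0` with `|A| + 1 ≤ |B|`, the function
`b z = (z + A)/B` is a nonconstant element of `H∞₁` and `H(b)` has the complete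
Nevanlinna–Pick property. -/
theorem affine_CNP (A B : ℂ) (hB : B ≠ 0) (hAB : ‖A‖ + 1 ≤ ‖B‖) :
    MemBallHinf (fun z => (z + A) / B) ∧ NonconstOnDisk (fun z => (z + A) / B) ∧
      HasCNP (fun z => (z + A) / B) := by
  have hα : 0 ≤ ‖A‖ := norm_nonneg A
  have hβ : 0 < ‖B‖ := norm_pos_iff.mpr hB
  have hlt : ∀ z ∈ unitDisk, ‖z + A‖ < ‖B‖ := fun z hz => by
    linarith [norm_add_le z A, norm_lt_one_of_mem_unitDisk_s11 hz]
  have hden : ∀ z ∈ unitDisk, ∀ w ∈ unitDisk, 1 - starRingEnd ℂ w * z ≠ 0 := by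
    intro z hz w hw h
    have h1 : ‖starRingEnd ℂ w * z‖ = 1 := by rw [← sub_eq_zero.mp h, norm_one]
    rw [norm_mul, RCLike.norm_conj] at h1
    nlinarith [norm_lt_one_of_mem_unitDisk_s11 hz, norm_lt_one_of_mem_unitDisk_s11 hw, norm_nonneg z,
      norm_nonneg w]
  have hnum : ∀ z ∈ unitDisk, ∀ w ∈ unitDisk,
      B * starRingEnd ℂ B - (z + A) * (starRingEnd ℂ w + starRingEnd ℂ A) ≠ 0 := by
    intro z hz w hw h
    have h1 := congrArg norm (sub_eq_zero.mp h)
    rw [← map_add, norm_mul, norm_mul, RCLike.norm_conj, RCLike.norm_conj] at h1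
    nlinarith [hlt z hz, hlt w hw, norm_nonneg (z + A), norm_nonneg (w + A)]
  have hB' : starRingEnd ℂ B ≠ 0 := (map_ne_zero _).mpr hB
  refine ⟨⟨by fun_prop, fun z hz => ?_⟩,
    ⟨0, by simp [unitDisk], 1 / 2, by simp [unitDisk]; norm_num, ?_⟩, fun z hz w hw => ?_, ?_⟩
  · rw [norm_div]
    exact div_le_one_of_le₀ (hlt z hz).le hβ.le
  · intro h
    simp [div_left_inj' hB] at h
  · refine div_ne_zero ?_ (hden z hz w hw)
    have := hnum z hz w hw
    have h1 : 1 - starRingEnd ℂ ((w + A) / B) * ((z + A) / B) =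
        (B * starRingEnd ℂ B - (z + A) * (starRingEnd ℂ w + starRingEnd ℂ A)) /
          (B * starRingEnd ℂ B) := by
      rw [map_div₀, map_add]
      field_simp
    rw [h1]
    exact div_ne_zero this (mul_ne_zero hB hB')
  · obtain ⟨ω, hω, hA⟩ := exists_norm_eq_one_conj_eq A
    have hA' : starRingEnd ℂ A = ‖A‖ * ω := by
      conv_lhs => rw [hA]
      simp
    set α := ‖A‖
    set β := ‖B‖
    set R : ℝ := β ^ 2 - α ^ 2 with hR
    have hRC : (R : ℂ) = (β : ℂ) ^ 2 - (α : ℂ) ^ 2 := by rw [hR]; push_cast; rfl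
    have hBB : B * starRingEnd ℂ B = (β : ℂ) ^ 2 := mul_conj' B
    have hAA : A * starRingEnd ℂ A = (α : ℂ) ^ 2 := mul_conj' A
    have hβR : β + α ≤ R := by nlinarith
    have hRpos : 0 < R := by linarith
    have hR0 : (R : ℂ) ≠ 0 := ofReal_ne_zero.mpr hRpos.ne'
    have hωn : ‖ω‖ = 1 := by
      have := congrArg norm hω
      rw [norm_mul, RCLike.norm_conj, norm_one] at this
      nlinarith [norm_nonneg ω]
    have hu : ∀ z ∈ unitDisk, β ≤ ‖(R : ℂ) - α * ω * z‖ := by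
      intro z hz
      have h1 := norm_sub_norm_le (R : ℂ) (α * ω * z)
      rw [norm_mul, norm_mul, hωn, norm_real, norm_real, Real.norm_of_nonneg hRpos.le,
        Real.norm_of_nonneg hα] at h1
      nlinarith [norm_lt_one_of_mem_unitDisk_s11 hz]
    have hu0 : ∀ z ∈ unitDisk, (R : ℂ) - α * ω * z ≠ 0 := fun z hz =>
      norm_pos_iff.mp (hβ.trans_le (hu z hz))
    set φ : ℂ → ℂ := fun z => β * z / (R - α * ω * z) with hφ
    have hφ1 : ∀ z ∈ unitDisk, ‖φ z‖ < 1 := by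
      intro z hz
      have h1 := hu z hz
      rw [hφ, norm_div, norm_mul, norm_real, Real.norm_of_nonneg hβ.le,
        div_lt_one (hβ.trans_le h1)]
      nlinarith [norm_lt_one_of_mem_unitDisk_s11 hz]
    have hc : 0 ≤ 1 - ((β + α) / R) ^ 2 := by
      have h1 : (β + α) / R ≤ 1 := (div_le_one hRpos).mpr hβR
      have h2 : 0 ≤ (β + α) / R := by positivity
      nlinarith
    refine ((((isPosKernel_szego (fun z => z) φ hφ1).const_mul hc).add
      ((isPosKernel_mul_conj fun z => z).const_mul
        (r := (β + α) * α / R ^ 2) (by positivity))).add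
      ((isPosKernel_szego (fun z => z * (1 - ω * φ z)) φ hφ1).const_mul
        (r := β * α / R ^ 2) (by positivity))).congr_s11 fun z hz w hw => ?_
    have hRA : (R : ℂ) = B * starRingEnd ℂ B - A * starRingEnd ℂ A := by rw [hBB, hAA, hRC]
    have hM : ((R : ℂ) - starRingEnd ℂ A * z) * (R - A * starRingEnd ℂ w) -
        B * starRingEnd ℂ B * (z * starRingEnd ℂ w) ≠ 0 := by
      convert mul_ne_zero hR0 (hnum z hz w hw) using 1
      rw [hRA]
      ring
    have hu0' : (R : ℂ) - α * starRingEnd ℂ ω * starRingEnd ℂ w ≠ 0 := by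
      simpa using (map_ne_zero (starRingEnd ℂ)).mpr (hu0 w hw)
    have e1 := affine_pick_defect hB hB' hRA hR0 (hnum z hz w hw)
    rw [hBB, hA', hA] at hM
    have e2 := affine_pick_decomposition hRC hR0 hω rfl rfl (hu0 z hz) hu0' hM
    simp only [dbrKernel, map_div₀, map_add, map_zero, zero_add, zero_mul, mul_zero, sub_zero,
      div_one]
    rw [e1, hBB, hA', hA, e2]
    simp [hφ]
end
end
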